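/- arXiv:2312.09905 — 4 statements merged into one kernel-verified Lean document; each statement's English description precedes it below -/
import Mathlib

section
/- Let D be a digraph with chromatic number at least 2n−3, where n ≥ 7. Then for all positive integers k, l with k + l = n − 2, D contains the oriented path P(k,1,l) of length n−1. -/
/-- `ContainsP3 D k l r` : the digraph `D` contains the oriented path
`P(k,l,r)` consisting of `k` forward arcs, then `l` backward arcs, then `r`
forward arcs. -/
def ContainsP3 {V : Type*} (D : V → V → Prop) (k l r : ℕ) : Prop :=
  ∃ x : Fin (k + l + r + 1) → V, Function.Injective x ∧
    (∀ i : ℕ, ∀ _ : i < k, D (x ⟨i, by omega⟩) (x ⟨i + 1, by omega⟩)) ∧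
    (∀ i : ℕ, ∀ _ : k ≤ i ∧ i < k + l, D (x ⟨i + 1, by omega⟩) (x ⟨i, by omega⟩)) ∧
    (∀ i : ℕ, ∀ _ : k + l ≤ i ∧ i < k + l + r, D (x ⟨i, by omega⟩) (x ⟨i + 1, by omega⟩))

/-- A maximal acyclic subrelation of a relation on a finite type: every arc left out closes a
cycle. -/
theorem exists_maximal_acyclic {V : Type*} [Finite V] (D : V → V → Prop) :
    ∃ G : V → V → Prop, (∀ u v, G u v → D u v) ∧ (∀ v, ¬ Relation.TransGen G v v) ∧
      ∀ u v, u ≠ v → D u v → ¬ G u v → Relation.TransGen G v u := by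
  obtain ⟨G, hG⟩ := (Set.toFinite
    {G : V → V → Prop | (∀ u v, G u v → D u v) ∧ ∀ v, ¬ Relation.TransGen G v v}).exists_maximal
    ⟨fun _ _ => False, fun _ _ h => h.elim, fun v h => by
      obtain ⟨_, h, _⟩ := Relation.TransGen.head'_iff.1 h
      exact h⟩
  obtain ⟨⟨hGD, hac⟩, hmax⟩ := hG
  refine ⟨G, hGD, hac, fun u v huv hD hnG => ?_⟩
  by_contra hvu
  have hreach : ∀ a b, Relation.TransGen (fun a b => G a b ∨ (a = u ∧ b = v)) a b →
      Relation.TransGen G a b ∨ (Relation.ReflTransGen G a u ∧ Relation.ReflTransGen G v b) := by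
    intro a b h
    induction h with
    | single h =>
      rcases h with h | ⟨rfl, rfl⟩
      · exact .inl (.single h)
      · exact .inr ⟨.refl, .refl⟩
    | tail _ h ih =>
      rcases h with h | ⟨rfl, rfl⟩
      · rcases ih with ih | ⟨ih₁, ih₂⟩
        · exact .inl (ih.tail h)
        · exact .inr ⟨ih₁, ih₂.tail h⟩
      · rcases ih with ih | ⟨ih₁, _⟩
        · exact .inr ⟨ih.to_reflTransGen, .refl⟩
        · exact .inr ⟨ih₁, .refl⟩
  refine hnG (hmax (y := fun a b => G a b ∨ (a = u ∧ b = v)) ⟨?_, ?_⟩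
    (fun a b h => Or.inl h) u v (Or.inr ⟨rfl, rfl⟩))
  · rintro a b (h | ⟨rfl, rfl⟩)
    · exact hGD a b h
    · exact hD
  · intro a h
    rcases hreach a a h with h | ⟨h₁, h₂⟩
    · exact hac a h
    · rcases Relation.reflTransGen_iff_eq_or_transGen.1 (h₂.trans h₁) with h | h
      · exact huv h
      · exact hvu h

/-- The longest-path rank of an acyclic relation on a finite type, with a choice for every `v` of
a path that ends at `v` and has `r v` arcs, listed backwards. -/
theorem exists_rank_of_acyclic {V : Type*} [Finite V] (G : V → V → Prop)
    (hac : ∀ v, ¬ Relation.TransGen G v v) :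
    ∃ (r : V → ℕ) (p : V → ℕ → V), (∀ u v, G u v → r u < r v) ∧
      (∀ v, p v 0 = v) ∧ ∀ v i, i < r v → G (p v (i + 1)) (p v i) := by
  classical
  have := Fintype.ofFinite V
  have hwf : WellFounded G := by
    have : Std.Irrefl (Relation.TransGen G) := ⟨hac⟩
    exact (Finite.wellFounded_of_trans_of_irrefl (Relation.TransGen G)).mono
      fun _ _ h => .single h
  let r : V → ℕ := hwf.fix fun v ih =>
    Finset.univ.sup fun u => if h : G u v then ih u h + 1 else 0
  have hr : ∀ v, r v = Finset.univ.sup fun u => if G u v then r u + 1 else 0 := by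
    intro v
    simpa using hwf.fix_eq (C := fun _ => ℕ) (fun v ih =>
      Finset.univ.sup fun u => if h : G u v then ih u h + 1 else 0) v
  have hmono : ∀ u v, G u v → r u < r v := by
    intro u v h
    have := Finset.le_sup (f := fun u => if G u v then r u + 1 else 0) (Finset.mem_univ u)
    rw [← hr v] at this
    simpa [h] using this
  have hpred : ∀ v, ∃ u, 0 < r v → G u v ∧ r u + 1 = r v := by
    intro v
    obtain ⟨u, -, hu⟩ := Finset.exists_mem_eq_sup Finset.univ ⟨v, Finset.mem_univ v⟩
      (fun u => if G u v then r u + 1 else 0)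
    rw [← hr v] at hu
    refine ⟨u, fun h => ?_⟩
    by_cases hG : G u v
    · exact ⟨hG, by simpa [hG] using hu.symm⟩
    · simp [hG] at hu
      omega
  choose f hf using hpred
  have hrf : ∀ v i, i ≤ r v → r (f^[i] v) + i = r v := by
    intro v i
    induction i with
    | zero => simp
    | succ i ih =>
      intro hi
      rw [Function.iterate_succ_apply']
      have := ih (by omega)
      have := (hf (f^[i] v) (by omega)).2
      omega
  refine ⟨r, fun v i => f^[i] v, hmono, fun _ => rfl, fun v i hi => ?_⟩
  have := hrf v i hi.le
  simp only [Function.iterate_succ_apply']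
  exact (hf _ (by omega)).1

/-- A function that decreases a measure on `P` gives a forest, which is 2-colourable. -/
theorem exists_bool_coloring_of_decreasing {V : Type*} (m : V → ℕ) (P : V → Prop) (f : V → V)
    (hf : ∀ v, P v → m (f v) < m v) : ∃ b : V → Bool, ∀ v, P v → b v = !b (f v) := by
  classical
  let wf := (measure m).wf
  refine ⟨wf.fix fun v ih => if h : P v then !ih (f v) (hf v h) else true, fun v hv => ?_⟩
  rw [wf.fix_eq]
  simp [hv]

/-- `P(k,1,l)` from a directed path ending at `p 0`, a disjoint directed path starting at `q 0`,
and the arc from `q 0` to `p 0`. -/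
theorem ContainsP3.of_paths {V : Type*} {D : V → V → Prop} {k l : ℕ} (p q : ℕ → V)
    (hp : ∀ i < k, D (p (i + 1)) (p i)) (hq : ∀ i < l, D (q i) (q (i + 1)))
    (hqp : D (q 0) (p 0))
    (hpinj : ∀ i j, i < j → j ≤ k → p i ≠ p j) (hqinj : ∀ i j, i < j → j ≤ l → q i ≠ q j)
    (hdisj : ∀ i j, i ≤ k → j ≤ l → p i ≠ q j) : ContainsP3 D k 1 l := by
  refine ⟨fun i => if (i : ℕ) ≤ k then p (k - i) else q (i - (k + 1)), ?_, ?_, ?_, ?_⟩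
  · have hlt : ∀ i j : Fin (k + 1 + l + 1), i < j →
        (if (i : ℕ) ≤ k then p (k - i) else q (i - (k + 1))) ≠
          (if (j : ℕ) ≤ k then p (k - j) else q (j - (k + 1))) := by
      rintro ⟨i, hi⟩ ⟨j, hj⟩ hij
      simp only [Fin.mk_lt_mk] at hij ⊢
      split_ifs
      · exact (hpinj _ _ (by omega) (by omega)).symm
      · exact hdisj _ _ (by omega) (by omega)
      · omega
      · exact hqinj _ _ (by omega) (by omega)
    intro i j hij
    by_contra hne
    rcases lt_or_gt_of_ne hne with h | h
    · exact hlt i j h hij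
    · exact hlt j i h hij.symm
  · intro i hi
    have h := hp (k - (i + 1)) (by omega)
    rw [show k - (i + 1) + 1 = k - i by omega] at h
    simpa [hi.le, Nat.succ_le_of_lt hi] using h
  · rintro i ⟨hi, hi'⟩
    obtain rfl : i = k := by omega
    simpa using hqp
  · rintro i ⟨hi, hi'⟩
    have h := hq (i - (k + 1)) (by omega)
    rw [show i - (k + 1) + 1 = i - k by omega] at h
    simpa [show ¬ i ≤ k by omega, show ¬ i + 1 ≤ k by omega] using h

/-- A digraph without `P(k,1,l)` is `(k + l + 4)`-colourable. -/
theorem colorable_of_not_containsP3 {V : Type*} [Finite V] (D : V → V → Prop) {k l : ℕ}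
    (hD : ¬ ContainsP3 D k 1 l) :
    (SimpleGraph.fromRel D).Colorable (k + l + 4) := by
  classical
  obtain ⟨G, hGD, hac, hback⟩ := exists_maximal_acyclic D
  -- `r` and `c` count the arcs of a longest `G`-path ending, respectively starting, at a vertex.
  obtain ⟨r, p, hr, hp0, hp⟩ := exists_rank_of_acyclic G hac
  obtain ⟨c, q, hc, hq0, hq⟩ := exists_rank_of_acyclic (Function.swap G)
    fun v h => hac v (Relation.transGen_swap.1 h)
  have hrT : ∀ {u v}, Relation.TransGen G u v → r u < r v := by
    intro u v h
    induction h with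
    | single h => exact hr _ _ h
    | tail _ h ih => exact ih.trans (hr _ _ h)
  have hcT : ∀ {u v}, Relation.TransGen G u v → c v < c u := by
    intro u v h
    induction h with
    | single h => exact hc _ _ h
    | tail _ h ih => exact (hc _ _ h).trans ih
  have hrp : ∀ v i j, i < j → j ≤ r v → r (p v j) < r (p v i) := by
    intro v i j hij
    induction j, hij using Nat.le_induction with
    | base => exact fun h => hr _ _ (hp v i h)
    | succ j _ ih => exact fun h => (hr _ _ (hp v j h)).trans (ih (by omega))
  have hrq : ∀ v i j, i < j → j ≤ c v → r (q v i) < r (q v j) := by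
    intro v i j hij
    induction j, hij using Nat.le_induction with
    | base => exact fun h => hr _ _ (hq v i h)
    | succ j _ ih => exact fun h => (ih (by omega)).trans (hr _ _ (hq v j h))
  have hrp0 : ∀ v i, i ≤ r v → p v i = v ∨ r (p v i) < r v := by
    intro v i hi
    rcases Nat.eq_zero_or_pos i with rfl | h
    · exact .inl (hp0 v)
    · exact .inr (by simpa [hp0] using hrp v 0 i h hi)
  have hrq0 : ∀ v i, i ≤ c v → q v i = v ∨ r v < r (q v i) := by
    intro v i hi
    rcases Nat.eq_zero_or_pos i with rfl | h
    · exact .inl (hq0 v)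
    · exact .inr (by simpa [hq0] using hrq v 0 i h hi)
  -- The middle vertices `H` span no arcs outside `G`.
  let H : V → Prop := fun v => k ≤ r v ∧ l ≤ c v
  have hforward : ∀ u v, u ≠ v → H u → H v → D u v → G u v := by
    intro u v huv hu hv h
    by_contra hG
    have hvu := hrT (hback u v huv h hG)
    refine hD (.of_paths (p v) (q u) (fun i hi => hGD _ _ (hp v i (hi.trans_le hv.1)))
      (fun i hi => hGD _ _ (hq u i (hi.trans_le hu.2))) (by simpa [hp0, hq0] using h) ?_ ?_ ?_)
    · intro i j hij hj h
      have := hrp v i j hij (hj.trans hv.1)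
      rw [h] at this
      omega
    · intro i j hij hj h
      have := hrq u i j hij (hj.trans hu.2)
      rw [h] at this
      omega
    · intro i j hi hj h
      have h₁ := hrp0 v i (hi.trans hv.1)
      have h₂ := hrq0 u j (hj.trans hu.2)
      rw [h] at h₁
      grind
  -- The lowest in-neighbour `f v` and the highest out-neighbour `g u` within `H`.
  have hfirst : ∀ v, ∃ w, (∃ u, H u ∧ G u v) →
      (H w ∧ G w v) ∧ ∀ u, H u → G u v → r w ≤ r u := by
    intro v
    by_cases h : ∃ u, H u ∧ G u v
    · obtain ⟨w, hw, hmin⟩ := Set.exists_min_image {u | H u ∧ G u v} r (Set.toFinite _) h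
      exact ⟨w, fun _ => ⟨hw, fun u hu hG => hmin u ⟨hu, hG⟩⟩⟩
    · exact ⟨v, fun h' => (h h').elim⟩
  have hlast : ∀ u, ∃ w, (∃ v, H v ∧ G u v) →
      (H w ∧ G u w) ∧ ∀ v, H v → G u v → r v ≤ r w := by
    intro u
    by_cases h : ∃ v, H v ∧ G u v
    · obtain ⟨w, hw, hmax⟩ := Set.exists_max_image {v | H v ∧ G u v} r (Set.toFinite _) h
      exact ⟨w, fun _ => ⟨hw, fun v hv hG => hmax v ⟨hv, hG⟩⟩⟩
    · exact ⟨u, fun h' => (h h').elim⟩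
  choose f hf using hfirst
  choose g hg using hlast
  have hforest : ∀ u v, H u → H v → G u v → f v = u ∨ g u = v := by
    intro u v hu hv huv
    by_contra! hne
    obtain ⟨⟨hfH, hfG⟩, hfmin⟩ := hf v ⟨u, hu, huv⟩
    obtain ⟨⟨hgH, hgG⟩, hgmax⟩ := hg u ⟨v, hv, huv⟩
    have hfu := hfmin u hu huv
    have hvg := hgmax v hv huv
    have hruv := hr _ _ huv
    have hrfv := hr _ _ hfG
    have hrug := hr _ _ hgG
    refine hD (.of_paths (fun i => if i = 0 then v else p (f v) (i - 1))
      (fun i => if i = 0 then u else q (g u) (i - 1)) ?_ ?_ (by simpa using hGD _ _ huv) ?_ ?_ ?_)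
    · rintro (_ | i) hi
      · simpa [hp0] using hGD _ _ hfG
      · simpa using hGD _ _ (hp (f v) i (by have := hfH.1; omega))
    · rintro (_ | i) hi
      · simpa [hq0] using hGD _ _ hgG
      · simpa using hGD _ _ (hq (g u) i (by have := hgH.2; omega))
    · rintro (_ | i) (_ | j) hij hj h
      · omega
      · have := hrp0 (f v) j (by have := hfH.1; omega)
        simp at h
        grind
      · omega
      · have := hrp (f v) i j (by omega) (by have := hfH.1; omega)
        simp at h
        grind
    · rintro (_ | i) (_ | j) hij hj h
      · omega
      · have := hrq0 (g u) j (by have := hgH.2; omega)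
        simp at h
        grind
      · omega
      · have := hrq (g u) i j (by omega) (by have := hgH.2; omega)
        simp at h
        grind
    · rintro (_ | i) (_ | j) hi hj h
      · simp at h
        grind
      · have := hrq0 (g u) j (by have := hgH.2; omega)
        simp at h
        grind
      · have := hrp0 (f v) i (by have := hfH.1; omega)
        simp at h
        grind
      · have := hrp0 (f v) i (by have := hfH.1; omega)
        have := hrq0 (g u) j (by have := hgH.2; omega)
        simp at h
        grind
  obtain ⟨a, ha⟩ := exists_bool_coloring_of_decreasing r (fun v => ∃ u, H u ∧ G u v) f
    fun v hv => hr _ _ (hf v hv).1.2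
  obtain ⟨b, hb⟩ := exists_bool_coloring_of_decreasing c (fun u => ∃ v, H v ∧ G u v) g
    fun u hu => hc _ _ (hg u hu).1.2
  let color : V → Fin k ⊕ Fin l ⊕ (Bool × Bool) := fun v =>
    if h : r v < k then .inl ⟨r v, h⟩
    else if h : c v < l then .inr (.inl ⟨c v, h⟩) else .inr (.inr (a v, b v))
  have hcolor : ∀ u v, u ≠ v → D u v → color u ≠ color v := by
    intro u v huv h heq
    have hne : r u ≠ r v ∧ c u ≠ c v := by
      by_cases hG : G u v
      · exact ⟨(hr _ _ hG).ne, (hc _ _ hG).ne'⟩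
      · have hT := hback u v huv h hG
        exact ⟨(hrT hT).ne', (hcT hT).ne⟩
    simp only [color] at heq
    split_ifs at heq <;> simp at heq
    · exact hne.1 heq
    · exact hne.2 heq
    · have hu : H u := ⟨by omega, by omega⟩
      have hv : H v := ⟨by omega, by omega⟩
      have hG := hforward u v huv hu hv h
      rcases hforest u v hu hv hG with h' | h'
      · have := ha v ⟨u, hu, hG⟩
        simp [h', heq.1] at this
      · have := hb u ⟨v, hv, hG⟩
        simp [h', heq.2] at this
  have C : (SimpleGraph.fromRel D).Coloring (Fin k ⊕ Fin l ⊕ (Bool × Bool)) :=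
    .mk color fun {u v} h => by
      rw [SimpleGraph.fromRel_adj] at h
      rcases h with ⟨huv, h | h⟩
      · exact hcolor u v huv h
      · exact (hcolor v u huv.symm h).symm
  have hcard := C.colorable
  simpa [add_assoc] using hcard

/-- Main theorem: every digraph with chromatic number at least `2n - 3` (`n ≥ 7`)
contains every oriented path `P(k,1,l)` of length `n - 1`. -/
theorem P_k_1_l_universal {V : Type*} [Fintype V] (D : V → V → Prop) (n k l : ℕ)
    (hn : 7 ≤ n) (hk : 1 ≤ k) (hl : 1 ≤ l) (hkl : k + l = n - 2)
    (hchrom : ((2 * n - 3 : ℕ) : ℕ∞) ≤ (SimpleGraph.fromRel D).chromaticNumber) :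
    ContainsP3 D k 1 l := by
  by_contra hD
  have h := hchrom.trans (colorable_of_not_containsP3 D hD).chromaticNumber_le
  have : 2 * n - 3 ≤ k + l + 4 := by exact_mod_cast h
  omega
end

section
/- Let D be a digraph containing no oriented path P(k,l,r) with k,l,r ≥ 2, k+l+r = n−1 and l ≤ k ≤ r. Then the chromatic number of D is at most 2(n−1)+r. -/
/-- `ColorableOn D S n` : the subdigraph of `D` induced by `S` has a proper colouring with
`n` colours; loops are ignored. -/
def ColorableOn {V : Type*} (D : V → V → Prop) (S : Set V) (n : ℕ) : Prop :=
  ∃ c : V → ℕ, (∀ x ∈ S, c x < n) ∧ ∀ x ∈ S, ∀ y ∈ S, D x y → x ≠ y → c x ≠ c y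

/-- `OutPath D S m c` : `c 0 → c 1 → ⋯ → c m` is a directed path of `D` inside `S`. -/
structure OutPath {V : Type*} (D : V → V → Prop) (S : Set V) (m : ℕ) (c : ℕ → V) : Prop where
  mem : ∀ i ≤ m, c i ∈ S
  arc : ∀ i < m, D (c i) (c (i + 1))
  inj : ∀ i ≤ m, ∀ j ≤ m, c i = c j → i = j

section

variable {V : Type*} {D : V → V → Prop}

theorem ColorableOn.union {S T : Set V} {m n : ℕ} (hS : ColorableOn D S m)
    (hT : ColorableOn D T n) : ColorableOn D (S ∪ T) (m + n) := by
  classical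
  obtain ⟨c, hc, hc'⟩ := hS
  obtain ⟨d, hd, hd'⟩ := hT
  refine ⟨fun x => if x ∈ S then c x else m + d x, ?_, ?_⟩
  · intro x hx
    by_cases h : x ∈ S
    · have := hc x h
      simp only [h, if_true]
      omega
    · have := hd x (hx.resolve_left h)
      simp only [h, if_false]
      omega
  · intro x hx y hy hxy hne
    by_cases h : x ∈ S <;> by_cases h' : y ∈ S <;> simp only [h, h', if_true, if_false]
    · exact hc' x h y h' hxy hne
    · have := hc x h
      omega
    · have := hc y h'
      omega
    · have := hd' x (hx.resolve_left h) y (hy.resolve_left h') hxy hne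
      omega

theorem ColorableOn.of_flip {S : Set V} {n : ℕ} (h : ColorableOn (flip D) S n) :
    ColorableOn D S n := by
  obtain ⟨c, hc, hc'⟩ := h
  exact ⟨c, hc, fun x hx y hy hxy hne => (hc' y hy x hx hxy hne.symm).symm⟩

/-- A proper levelling of a finite digraph in which every vertex of positive level has an
in-neighbour on the level just below. -/
theorem exists_level [Fintype V] (D : V → V → Prop) :
    ∃ f : V → ℕ, (∀ x y, D x y → x ≠ y → f x ≠ f y) ∧
      ∀ v, 0 < f v → ∃ u, D u v ∧ f u + 1 = f v := by
  classical
  let bad : (V → ℕ) → Set (V × V) := fun f => {p | D p.1 p.2 ∧ ¬ f p.1 < f p.2}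
  let μ : (V → ℕ) → ℕ ×ₗ ℕ := fun f => toLex ((bad f).ncard, ∑ v, f v)
  obtain ⟨f, -, hf⟩ := (InvImage.wf μ wellFounded_lt).has_min Set.univ ⟨fun _ => 0, trivial⟩
  have hmin : ∀ g, ¬ μ g < μ f := fun g => hf g trivial
  refine ⟨f, ?_, ?_⟩
  · intro x y hxy hne heq
    let g : V → ℕ := fun w => if w = y then 2 * f y + 1 else 2 * f w
    have hg : ∀ u v, f u < f v → g u < g v := by
      intro u v huv
      by_cases hu : u = y <;> by_cases hv : v = y <;> simp only [g, hu, hv, if_true, if_false] <;>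
        subst_vars <;> omega
    refine hmin g (Prod.Lex.toLex_lt_toLex.2 (Or.inl (Set.ncard_lt_ncard ?_ (Set.toFinite _))))
    refine ⟨fun p hp => ⟨hp.1, fun h => hp.2 (hg _ _ h)⟩, fun hsub => ?_⟩
    have hmem : (x, y) ∈ bad f := ⟨hxy, by simp [heq]⟩
    exact (hsub hmem).2 (by simp [g, hne, heq])
  · intro v hv
    by_contra hno
    push Not at hno
    let g : V → ℕ := Function.update f v (f v - 1)
    have hgv : g v = f v - 1 := by simp [g]
    have hgo : ∀ w, w ≠ v → g w = f w := fun w hw => by simp [g, hw]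
    have hsub : bad g ⊆ bad f := by
      rintro ⟨a, b⟩ ⟨hab, hnot⟩
      refine ⟨hab, fun hlt => hnot ?_⟩
      simp only at hab hlt ⊢
      by_cases ha : a = v
      · have hb : b ≠ v := by rintro rfl; subst ha; omega
        rw [ha, hgv, hgo b hb]
        subst ha
        omega
      · rw [hgo a ha]
        by_cases hb : b = v
        · subst hb
          have := hno a hab
          omega
        · rwa [hgo b hb]
    have hsum : ∑ w, g w < ∑ w, f w := by
      refine Finset.sum_lt_sum (fun w _ => ?_) ⟨v, Finset.mem_univ v, by omega⟩
      by_cases hw : w = v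
      · subst hw
        omega
      · exact (hgo w hw).le
    refine hmin g (Prod.Lex.toLex_lt_toLex.2 ?_)
    rcases (Set.ncard_le_ncard hsub (Set.toFinite _)).lt_or_eq with h | h
    · exact Or.inl h
    · exact Or.inr ⟨h, hsum⟩

/-- Levelling of the subdigraph induced by `S`, with chains descending one level at a time. -/
theorem exists_level_chain [Fintype V] (D : V → V → Prop) (S : Set V) :
    ∃ (f : V → ℕ) (a : V → ℕ → V), (∀ x ∈ S, ∀ y ∈ S, D x y → x ≠ y → f x ≠ f y) ∧
      ∀ v ∈ S, a v 0 = v ∧ ∀ i ≤ f v, a v i ∈ S ∧ f (a v i) + i = f v ∧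
        (i < f v → D (a v (i + 1)) (a v i)) := by
  obtain ⟨f, hf, hpar⟩ := exists_level fun x y => D x y ∧ x ∈ S ∧ y ∈ S
  have hpar' : ∀ v, ∃ u, 0 < f v → (D u v ∧ u ∈ S ∧ v ∈ S) ∧ f u + 1 = f v := by
    intro v
    by_cases h : 0 < f v
    · obtain ⟨u, hu⟩ := hpar v h
      exact ⟨u, fun _ => hu⟩
    · exact ⟨v, fun h' => absurd h' h⟩
  choose π hπ using hpar'
  refine ⟨f, fun v i => π^[i] v, fun x hx y hy h => hf x y ⟨h, hx, hy⟩, fun v hv => ⟨rfl, ?_⟩⟩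
  have hlev : ∀ i ≤ f v, π^[i] v ∈ S ∧ f (π^[i] v) + i = f v := by
    intro i
    induction i with
    | zero => exact fun _ => ⟨hv, rfl⟩
    | succ i ih =>
      intro hi
      obtain ⟨-, h2⟩ := ih (by omega)
      obtain ⟨h3, h4⟩ := hπ (π^[i] v) (by omega)
      rw [Function.iterate_succ_apply']
      exact ⟨h3.2.1, by omega⟩
  intro i hi
  refine ⟨(hlev i hi).1, (hlev i hi).2, fun hlt => ?_⟩
  have := (hlev i hi).2
  simp only [Function.iterate_succ_apply']
  exact (hπ (π^[i] v) (by omega)).1.1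

/-- Gallai–Roy: a digraph without a directed path of length `m` is `m`-colourable. -/
theorem colorableOn_of_forall_not_outPath [Fintype V] {S : Set V} {m : ℕ}
    (h : ∀ c, ¬ OutPath D S m c) : ColorableOn D S m := by
  obtain ⟨f, a, hf, ha⟩ := exists_level_chain D S
  refine ⟨f, fun v hv => ?_, hf⟩
  by_contra hlt
  obtain ⟨-, hchain⟩ := ha v hv
  refine h (fun i => a v (m - i)) ⟨fun i hi => (hchain _ (by omega)).1, fun i hi => ?_, ?_⟩
  · have := (hchain (m - (i + 1)) (by omega)).2.2 (by omega)
    rwa [show m - (i + 1) + 1 = m - i by omega] at this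
  · intro i hi j hj hij
    have h1 := (hchain (m - i) (by omega)).2.1
    have h2 := (hchain (m - j) (by omega)).2.1
    rw [hij] at h1
    omega

/-- A digraph that is not `(p + q + 1)`-colourable has two directed paths, of lengths `p` and
`q`, that end at the same vertex and are otherwise disjoint. -/
theorem exists_two_blocks [Fintype V] {S : Set V} {p q : ℕ}
    (h : ¬ ColorableOn D S (p + q + 1)) :
    ∃ a b : ℕ → V, OutPath (flip D) S p a ∧ OutPath (flip D) S q b ∧ a 0 = b 0 ∧
      ∀ i ≤ p, ∀ j ≤ q, a i = b j → i = 0 ∧ j = 0 := by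
  obtain ⟨f, A, hf, hA⟩ := exists_level_chain D S
  -- Two vertices at distance more than `q` in level, the lower one on level at least `p`.
  obtain ⟨x, hx, y, hy, hxy, hpx, hpy, hgap⟩ : ∃ x ∈ S, ∃ y ∈ S, D x y ∧ p ≤ f x ∧ p ≤ f y ∧
      (f x + q < f y ∨ f y + q < f x) := by
    by_contra hno
    push Not at hno
    refine h ⟨fun v => if f v < p then f v else p + f v % (q + 1), fun v _ => ?_, ?_⟩
    · have : f v % (q + 1) < q + 1 := Nat.mod_lt _ (Nat.succ_pos q)
      dsimp only
      split_ifs <;> omega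
    · intro x hx y hy hxy hne heq
      have hlev := hf x hx y hy hxy hne
      dsimp only at heq
      split_ifs at heq with h1 h2 h2
      · exact hlev heq
      · omega
      · omega
      · have hle := hno x hx y hy hxy (by omega) (by omega)
        have hmod : f x ≡ f y [MOD q + 1] := Nat.add_left_cancel heq
        rcases Nat.lt_or_gt_of_ne hlev with hlt | hlt
        · have := Nat.le_of_dvd (by omega) ((Nat.modEq_iff_dvd' hlt.le).1 hmod)
          omega
        · have := Nat.le_of_dvd (by omega) ((Nat.modEq_iff_dvd' hlt.le).1 hmod.symm)
          omega
  obtain ⟨hx0, hxc⟩ := hA x hx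
  obtain ⟨hy0, hyc⟩ := hA y hy
  -- The chain of `y`, and the chain of `x` prolonged by the arc from `x` to `y`.
  have straight : ∀ m ≤ f y, OutPath (flip D) S m (A y) := by
    refine fun m hm => ⟨fun i hi => (hyc i (by omega)).1,
      fun i hi => (hyc i (by omega)).2.2 (by omega), fun i hi j hj hij => ?_⟩
    have h1 := (hyc i (by omega)).2.1
    have h2 := (hyc j (by omega)).2.1
    rw [hij] at h1
    omega
  let B : ℕ → V := fun i => if i = 0 then y else A x (i - 1)
  have hB0 : B 0 = y := rfl
  have hBs : ∀ i, B (i + 1) = A x i := fun i => rfl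
  have bent : ∀ m ≤ f x + 1, (∀ i < m, f y + i ≠ f x) → OutPath (flip D) S m B := by
    intro m hm hoff
    refine ⟨fun i hi => ?_, fun i hi => ?_, fun i hi j hj hij => ?_⟩
    · rcases i with - | i
      · exact hy
      · exact (hxc i (by omega)).1
    · rcases i with - | i
      · change D (B (0 + 1)) (B 0)
        rwa [hBs, hx0]
      · exact (hxc i (by omega)).2.2 (by omega)
    · rcases i with - | i <;> rcases j with - | j
      · rfl
      · rw [hB0, hBs] at hij
        have h1 := (hxc j (by omega)).2.1
        rw [← hij] at h1
        exact absurd h1 (hoff j (by omega))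
      · rw [hB0, hBs] at hij
        have h1 := (hxc i (by omega)).2.1
        rw [hij] at h1
        exact absurd h1 (hoff i (by omega))
      · rw [hBs, hBs] at hij
        have h1 := (hxc i (by omega)).2.1
        have h2 := (hxc j (by omega)).2.1
        rw [hij] at h1
        omega
  rcases hgap with hgap | hgap
  · refine ⟨B, A y, bent p (by omega) (by intros; omega), straight q (by omega), hy0.symm, ?_⟩
    intro i hi j hj hij
    have h1 := (hyc j (by omega)).2.1
    rcases i with - | i
    · rw [← hij, hB0] at h1
      omega
    · have h2 := (hxc i (by omega)).2.1
      rw [← hij, hBs] at h1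
      omega
  · refine ⟨A y, B, straight p (by omega), bent q (by omega) (by intros; omega), hy0, ?_⟩
    intro i hi j hj hij
    have h1 := (hyc i (by omega)).2.1
    rcases j with - | j
    · rw [hij, hB0] at h1
      omega
    · have h2 := (hxc j (by omega)).2.1
      rw [hij, hBs] at h1
      omega

/-- Glueing a path `a` into `t`, a path `b` from `s` to `t` and a path `c` out of `s`. -/
theorem containsP3_of_paths {k l r : ℕ} {R S T : Set V} {a b c : ℕ → V}
    (ha : OutPath (flip D) R k a) (hb : OutPath D S l b) (hc : OutPath D T r c)
    (hab : a 0 = b l) (hbc : b 0 = c 0)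
    (dab : ∀ i ≤ k, ∀ j ≤ l, a i = b j → i = 0) (dbc : ∀ i ≤ l, ∀ j ≤ r, b i = c j → j = 0)
    (dac : ∀ i ≤ k, ∀ j ≤ r, a i = c j → i = 0 ∨ j = 0) : ContainsP3 D k l r := by
  let x : ℕ → V := fun i => if i ≤ k then a (k - i) else if i ≤ k + l then b (k + l - i)
    else c (i - (k + l))
  have hxa : ∀ i ≤ k, x i = a (k - i) := fun i hi => by simp [x, hi]
  have hxb : ∀ i, k ≤ i → i ≤ k + l → x i = b (k + l - i) := by
    intro i h1 h2
    rcases h1.eq_or_lt with rfl | h1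
    · rw [hxa _ le_rfl]
      simpa using hab
    · simp [x, h2, Nat.not_le.2 h1]
  have hxc : ∀ i, k + l ≤ i → x i = c (i - (k + l)) := by
    intro i h1
    rcases h1.eq_or_lt with rfl | h1
    · rw [hxb _ (by omega) le_rfl]
      simpa using hbc
    · simp [x, Nat.not_le.2 h1, show ¬ i ≤ k by omega]
  have hinj : ∀ i j, i < j → j ≤ k + l + r → x i ≠ x j := by
    intro i j hij hj heq
    rcases le_total i k with hi | hi
    · rw [hxa i hi] at heq
      rcases le_total j k with hj' | hj'
      · rw [hxa j hj'] at heq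
        have := ha.inj _ (by omega) _ (by omega) heq
        omega
      rcases le_total j (k + l) with hj'' | hj''
      · rw [hxb j hj' hj''] at heq
        have h0 := dab _ (by omega) _ (by omega) heq
        rw [h0, hab] at heq
        have := hb.inj _ (by omega) _ (by omega) heq
        omega
      · rw [hxc j hj''] at heq
        rcases dac _ (by omega) _ (by omega) heq with h0 | h0
        · rw [h0, hab] at heq
          have h1 := dbc _ le_rfl _ (by omega) heq
          rw [h1, ← hbc] at heq
          have := hb.inj _ le_rfl _ (by omega) heq
          omega
        · rw [h0, ← hbc] at heq
          have h1 := dab _ (by omega) _ (by omega) heq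
          rw [h1, hab] at heq
          have := hb.inj _ le_rfl _ (by omega) heq
          omega
    rcases le_total i (k + l) with hi' | hi'
    · rw [hxb i hi hi'] at heq
      rcases le_total j (k + l) with hj' | hj'
      · rw [hxb j (by omega) hj'] at heq
        have := hb.inj _ (by omega) _ (by omega) heq
        omega
      · rw [hxc j hj'] at heq
        have h0 := dbc _ (by omega) _ (by omega) heq
        rw [h0, ← hbc] at heq
        have := hb.inj _ (by omega) _ (by omega) heq
        omega
    · rw [hxc i hi', hxc j (by omega)] at heq
      have := hc.inj _ (by omega) _ (by omega) heq
      omega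
  refine ⟨fun i => x i, fun i j hij => ?_, fun i hi => ?_, fun i hi => ?_, fun i hi => ?_⟩
  · have h1 := i.2
    have h2 := j.2
    by_contra hne
    rcases Nat.lt_or_gt_of_ne (fun h => hne (Fin.ext h)) with h | h
    · exact hinj _ _ h (by omega) hij
    · exact hinj _ _ h (by omega) hij.symm
  · dsimp only
    rw [hxa i (by omega), hxa (i + 1) (by omega)]
    have := ha.arc (k - (i + 1)) (by omega)
    rwa [show k - (i + 1) + 1 = k - i by omega] at this
  · dsimp only
    rw [hxb i (by omega) (by omega), hxb (i + 1) (by omega) (by omega)]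
    have := hb.arc (k + l - (i + 1)) (by omega)
    rwa [show k + l - (i + 1) + 1 = k + l - i by omega] at this
  · dsimp only
    rw [hxc i (by omega), hxc (i + 1) (by omega)]
    have := hc.arc (i - (k + l)) (by omega)
    rwa [show i - (k + l) + 1 = i + 1 - (k + l) by omega] at this

theorem OutPath.reverse {S : Set V} {m : ℕ} {c : ℕ → V} (h : OutPath (flip D) S m c) :
    OutPath D S m fun i => c (m - i) := by
  refine ⟨fun i hi => h.mem _ (by omega), fun i hi => ?_, fun i hi j hj hij => ?_⟩
  · have := h.arc (m - (i + 1)) (by omega)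
    rwa [show m - (i + 1) + 1 = m - i by omega] at this
  · have := h.inj _ (by omega) _ (by omega) hij
    omega

/-- If every vertex of `S` is the end of a directed path of length `k` whose other vertices
avoid `S`, and `P(k,l,r)` does not occur, then `S` induces a digraph of small chromatic
number. -/
theorem colorableOn_of_inPath [Fintype V] {k l r : ℕ} (hfree : ¬ ContainsP3 D k l r) {S : Set V}
    (hS : ∀ v ∈ S, ∃ a, OutPath (flip D) Set.univ k a ∧ a 0 = v ∧
      ∀ i ≤ k, i ≠ 0 → a i ∉ S) : ColorableOn D S (l + r + 1) := by
  by_contra hcol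
  obtain ⟨b, c, hb, hc, hbc, hdisj⟩ := exists_two_blocks (D := flip D) (p := l) (q := r)
    fun h => hcol h.of_flip
  obtain ⟨a, ha, ha0, haS⟩ := hS (b l) (hb.mem l le_rfl)
  refine hfree (containsP3_of_paths ha hb hc ha0 hbc (fun i hi j hj h => ?_)
    (fun i hi j hj h => (hdisj i hi j hj h).2) fun i hi j hj h => ?_)
  · by_contra h0
    exact haS i hi h0 (h ▸ hb.mem j hj)
  · by_contra h0
    exact haS i hi (fun h1 => h0 (Or.inl h1)) (h ▸ hc.mem j hj)

/-- The counterpart of `colorableOn_of_inPath` for directed paths of length `r` leaving `S`. -/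
theorem colorableOn_of_outPath [Fintype V] {k l r : ℕ} (hfree : ¬ ContainsP3 D k l r) {S : Set V}
    (hS : ∀ v ∈ S, ∃ c, OutPath D Set.univ r c ∧ c 0 = v ∧
      ∀ i ≤ r, i ≠ 0 → c i ∉ S) : ColorableOn D S (k + l + 1) := by
  by_contra hcol
  obtain ⟨a, b, ha, hb, hab, hdisj⟩ := exists_two_blocks hcol
  obtain ⟨c, hc, hc0, hcS⟩ := hS (b l) (hb.mem l le_rfl)
  refine hfree (containsP3_of_paths ha hb.reverse hc (by simpa using hab) (by simpa using hc0.symm)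
    (fun i hi j hj h => (hdisj i hi _ (by omega) h).1) (fun i hi j hj h => ?_)
    fun i hi j hj h => ?_)
  · by_contra h0
    exact hcS j hj h0 (h ▸ hb.mem (l - i) (by omega))
  · by_contra h0
    exact hcS j hj (fun h1 => h0 (Or.inr h1)) (h ▸ ha.mem i hi)

/-- A `P(k,l,r)`-free digraph is `(2(k+l+r)+1)`-colourable. -/
theorem colorableOn_univ_of_not_containsP3 [Fintype V] {k l r : ℕ}
    (hfree : ¬ ContainsP3 D k l r) :
    ColorableOn D Set.univ ((k + r - 1) + (l + r + 1) + (k + l + 1)) := by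
  obtain ⟨U, hU⟩ := (Set.toFinite {U : Set V | ∀ c, ¬ OutPath D U (k + r - 1) c}).exists_maximal
    ⟨∅, fun c hc => hc.mem 0 (Nat.zero_le _)⟩
  let I : Set V := {v | v ∉ U ∧ ∃ a, OutPath (flip D) Set.univ k a ∧ a 0 = v ∧
    ∀ i ≤ k, i ≠ 0 → a i ∈ U}
  let J : Set V := {v | v ∉ U ∧ ∃ c, OutPath D Set.univ r c ∧ c 0 = v ∧
    ∀ i ≤ r, i ≠ 0 → c i ∈ U}
  have hI : ColorableOn D I (l + r + 1) := colorableOn_of_inPath hfree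
    fun v ⟨_, a, ha, ha0, haU⟩ => ⟨a, ha, ha0, fun i hi h0 hiI => hiI.1 (haU i hi h0)⟩
  have hJ : ColorableOn D J (k + l + 1) := colorableOn_of_outPath hfree
    fun v ⟨_, c, hc, hc0, hcU⟩ => ⟨c, hc, hc0, fun i hi h0 hiJ => hiJ.1 (hcU i hi h0)⟩
  have hcover : U ∪ I ∪ J = Set.univ := by
    refine Set.eq_univ_of_forall fun v => ?_
    by_cases hv : v ∈ U
    · exact Or.inl (Or.inl hv)
    obtain ⟨p, hp⟩ : ∃ p, OutPath D (insert v U) (k + r - 1) p := by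
      by_contra hno
      push Not at hno
      exact hv (hU.2 (y := insert v U) hno (Set.subset_insert v U) (Set.mem_insert v U))
    obtain ⟨m, hm, rfl⟩ : ∃ m ≤ k + r - 1, p m = v := by
      by_contra hno
      push Not at hno
      exact hU.1 p ⟨fun i hi => (hp.mem i hi).resolve_left (hno i hi), hp.arc, hp.inj⟩
    have hpU : ∀ i ≤ k + r - 1, i ≠ m → p i ∈ U := fun i hi him =>
      (hp.mem i hi).resolve_left fun h => him (hp.inj i hi m hm h)
    by_cases hkm : k ≤ m
    · refine Or.inl (Or.inr ⟨hv, fun i => p (m - i), ⟨fun _ _ => trivial, fun i hi => ?_, ?_⟩, rfl,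
        fun i hi h0 => hpU _ (by omega) (by omega)⟩)
      · have := hp.arc (m - (i + 1)) (by omega)
        rwa [show m - (i + 1) + 1 = m - i by omega] at this
      · intro i hi j hj hij
        have := hp.inj _ (by omega) _ (by omega) hij
        omega
    · refine Or.inr ⟨hv, fun i => p (m + i), ⟨fun _ _ => trivial,
        fun i hi => hp.arc (m + i) (by omega), ?_⟩, rfl,
        fun i hi h0 => hpU _ (by omega) (by omega)⟩
      intro i hi j hj hij
      have := hp.inj _ (by omega) _ (by omega) hij
      omega
  rw [← hcover]
  exact ((colorableOn_of_forall_not_outPath hU.1).union hI).union hJ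

end

/-- Case 1 of Theorem 3.1: a `P(k,l,r)`-free digraph with `k+l+r = n-1`, `k,l,r ≥ 2`
and `l ≤ k ≤ r` has chromatic number at most `2 * (n - 1) + r`. -/
theorem three_blocks_case_1 {V : Type*} [Fintype V] (D : V → V → Prop) (n k l r : ℕ)
    (hk : 2 ≤ k) (hl : 2 ≤ l) (hr : 2 ≤ r)
    (hsum : k + l + r = n - 1) (h1 : l ≤ k) (h2 : k ≤ r)
    (hfree : ¬ ContainsP3 D k l r) :
    (SimpleGraph.fromRel D).chromaticNumber ≤ ((2 * (n - 1) + r : ℕ) : ℕ∞) := by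
  obtain ⟨c, hc, hc'⟩ := colorableOn_univ_of_not_containsP3 hfree
  refine SimpleGraph.Colorable.chromaticNumber_le ⟨SimpleGraph.Coloring.mk
    (fun v => (⟨c v, (hc v trivial).trans_le (by omega)⟩ : Fin (2 * (n - 1) + r))) ?_⟩
  intro v w hvw heq
  obtain ⟨hne, h | h⟩ := (SimpleGraph.fromRel_adj D v w).1 hvw
  · exact hc' v trivial w trivial h hne (congrArg Fin.val heq)
  · exact hc' w trivial v trivial h hne.symm (congrArg Fin.val heq).symm
end

section
/- Let D be a digraph containing no oriented path with three blocks P(k,l,r) where k+l+r = n−1, k,l,r ≥ 1. Then the chromatic number of D is at most 4n−13 (and at most 3n−6 when the block lengths satisfy l ≤ r, i.e., in the cases l ≤ k ≤ r and k ≤ l ≤ r). -/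
namespace ThreeBlocks

variable {V : Type*}

/-- `p 0, …, p m` is a directed path with `m` arcs of `D` inside `S`. -/
structure IsDPath (D : V → V → Prop) (S : Finset V) (p : ℕ → V) (m : ℕ) : Prop where
  mem : ∀ i ≤ m, p i ∈ S
  arc : ∀ i < m, D (p i) (p (i + 1))
  inj : ∀ i ≤ m, ∀ j ≤ m, p i = p j → i = j

/-- `D` restricted to `S` has a proper colouring with `m` colours. -/
def Col (D : V → V → Prop) (S : Finset V) (m : ℕ) : Prop :=
  ∃ c : V → ℕ, (∀ v ∈ S, c v < m) ∧ ∀ u ∈ S, ∀ v ∈ S, D u v → c u ≠ c v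

/-- `S` contains two directed paths, with `a` and `b` arcs, sharing exactly their last vertex. -/
def SinkPair (D : V → V → Prop) (S : Finset V) (a b : ℕ) : Prop :=
  ∃ p q, IsDPath D S p a ∧ IsDPath D S q b ∧ p a = q b ∧ ∀ i < a, ∀ j < b, p i ≠ q j

/-- The path `P(k,l,r)`, indexed by natural numbers. -/
def HasP3 (D : V → V → Prop) (k l r : ℕ) : Prop :=
  ∃ x : ℕ → V, (∀ i ≤ k + l + r, ∀ j ≤ k + l + r, x i = x j → i = j) ∧
    (∀ i < k, D (x i) (x (i + 1))) ∧
    (∀ i, k ≤ i → i < k + l → D (x (i + 1)) (x i)) ∧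
    (∀ i, k + l ≤ i → i < k + l + r → D (x i) (x (i + 1)))

theorem HasP3.of_flip {D : V → V → Prop} {k l r : ℕ} (h : HasP3 (flip D) r l k) :
    HasP3 D k l r := by
  obtain ⟨x, hi, h1, h2, h3⟩ := h
  refine ⟨fun i => x (k + l + r - i), ?_, ?_, ?_, ?_⟩
  · intro i hi' j hj' h
    have := hi _ (by omega) _ (by omega) h
    omega
  · intro i hk
    have := h3 (k + l + r - (i + 1)) (by omega) (by omega)
    rwa [show k + l + r - (i + 1) + 1 = k + l + r - i by omega] at this
  · intro i hk hl
    have := h2 (k + l + r - (i + 1)) (by omega) (by omega)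
    rwa [show k + l + r - (i + 1) + 1 = k + l + r - i by omega] at this
  · intro i hk hl
    have := h1 (k + l + r - (i + 1)) (by omega)
    rwa [show k + l + r - (i + 1) + 1 = k + l + r - i by omega] at this

theorem SinkPair.symm {D : V → V → Prop} {S : Finset V} {a b : ℕ} (h : SinkPair D S a b) :
    SinkPair D S b a := by
  obtain ⟨p, q, hp, hq, he, hd⟩ := h
  exact ⟨q, p, hq, hp, he.symm, fun i hi j hj h => hd j hj i hi h.symm⟩

theorem Col.mono {D : V → V → Prop} {S : Finset V} {m n : ℕ} (h : Col D S m) (hmn : m ≤ n) :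
    Col D S n := by
  obtain ⟨c, h1, h2⟩ := h
  exact ⟨c, fun v hv => (h1 v hv).trans_le hmn, h2⟩

theorem Col.of_flip {D : V → V → Prop} {S : Finset V} {m : ℕ} (h : Col (flip D) S m) :
    Col D S m := by
  obtain ⟨c, h1, h2⟩ := h
  exact ⟨c, h1, fun u hu v hv h => (h2 v hv u hu h).symm⟩

theorem Col.cover {D : V → V → Prop} {S A B : Finset V} {m n : ℕ} (hA : Col D A m)
    (hB : Col D B n) (hS : ∀ v ∈ S, v ∈ A ∨ v ∈ B) : Col D S (m + n) := by
  classical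
  obtain ⟨c, h1, h2⟩ := hA
  obtain ⟨d, h3, h4⟩ := hB
  refine ⟨fun v => if v ∈ A then c v else m + d v, ?_, ?_⟩
  · intro v hv
    by_cases h : v ∈ A
    · have := h1 v h
      simp only [h, if_true]; omega
    · have := h3 v ((hS v hv).resolve_left h)
      simp only [h, if_false]; omega
  · intro u hu v hv huv
    by_cases h : u ∈ A <;> by_cases h' : v ∈ A <;> simp only [h, h', if_true, if_false]
    · exact h2 u h v h' huv
    · have := h1 u h; omega
    · have := h1 v h'; omega
    · have := h4 u ((hS u hu).resolve_left h) v ((hS v hv).resolve_left h') huv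
      omega

theorem IsDPath.snoc {D : V → V → Prop} {S : Finset V} {p : ℕ → V} {m : ℕ} {w : V}
    (hp : IsDPath D S p m) (hw : w ∈ S) (ha : D (p m) w) (hn : ∀ i ≤ m, p i ≠ w) :
    IsDPath D S (fun i => if i ≤ m then p i else w) (m + 1) := by
  refine ⟨?_, ?_, ?_⟩
  · intro i _
    by_cases h : i ≤ m
    · simpa [h] using hp.mem i h
    · simpa [h] using hw
  · intro i hi
    rcases Nat.lt_or_ge i m with h | h
    · simpa [h.le, Nat.succ_le_iff.mpr h] using hp.arc i h
    · obtain rfl : i = m := by omega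
      simpa using ha
  · intro i hi j hj h
    by_cases h1 : i ≤ m <;> by_cases h2 : j ≤ m <;> simp only [h1, h2, if_true, if_false] at h
    · exact hp.inj i h1 j h2 h
    · exact absurd h (hn i h1)
    · exact absurd h.symm (hn j h2)
    · omega

theorem IsDPath.sub {D : V → V → Prop} {S : Finset V} {p : ℕ → V} {m : ℕ}
    (hp : IsDPath D S p m) (a b : ℕ) (h : a + b ≤ m) : IsDPath D S (fun i => p (a + i)) b :=
  ⟨fun i hi => hp.mem _ (by omega), fun i hi => hp.arc _ (by omega), fun i hi j hj h' => by
    have := hp.inj _ (by omega) _ (by omega) h'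
    omega⟩

/-- Levels: every vertex of positive level has an in-neighbour one level below, and every arc
that does not climb is closed into a cycle by arcs climbing one level at a time. -/
structure IsLevel (D : V → V → Prop) (S : Finset V) (f : V → ℕ) : Prop where
  pred : ∀ v ∈ S, f v ≠ 0 → ∃ u ∈ S, D u v ∧ f u + 1 = f v
  arc : ∀ u ∈ S, ∀ v ∈ S, D u v → f u < f v ∨
    Relation.ReflTransGen (fun a b => a ∈ S ∧ b ∈ S ∧ D a b ∧ f b = f a + 1) v u

theorem lt_card_of_pred {D : V → V → Prop} {S : Finset V} {f : V → ℕ}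
    (h : ∀ v ∈ S, f v ≠ 0 → ∃ u ∈ S, D u v ∧ f u + 1 = f v) {v : V} (hv : v ∈ S) :
    f v < S.card := by
  classical
  have key : ∀ n, ∀ v ∈ S, f v = n → Finset.range (n + 1) ⊆ S.image f := by
    intro n
    induction n with
    | zero =>
      intro v hv h0 i hi
      simp only [zero_add, Finset.range_one, Finset.mem_singleton] at hi
      exact Finset.mem_image.mpr ⟨v, hv, by omega⟩
    | succ n ih =>
      intro v hv h0 i hi
      obtain ⟨u, hu, _, h1⟩ := h v hv (by omega)
      rcases Nat.lt_or_ge i (n + 1) with h2 | h2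
      · exact ih u hu (by omega) (Finset.mem_range.mpr h2)
      · have := Finset.mem_range.mp hi
        exact Finset.mem_image.mpr ⟨v, hv, by omega⟩
  have h1 := Finset.card_le_card (key _ v hv rfl)
  have h2 : (S.image f).card ≤ S.card := Finset.card_image_le
  rw [Finset.card_range] at h1
  omega

theorem exists_isLevel (D : V → V → Prop) (S : Finset V) : ∃ f, IsLevel D S f := by
  classical
  let P : (V → ℕ) → Prop := fun f => ∀ v ∈ S, f v ≠ 0 → ∃ u ∈ S, D u v ∧ f u + 1 = f v
  let A : Set ℕ := {n | ∃ f, P f ∧ ∑ v ∈ S, f v = n}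
  have hne : A.Nonempty := ⟨0, fun _ => 0, fun v _ h => absurd rfl h, by simp⟩
  have hbd : BddAbove A := by
    refine ⟨S.card * S.card, ?_⟩
    rintro n ⟨f, hf, rfl⟩
    calc ∑ v ∈ S, f v ≤ ∑ _v ∈ S, S.card :=
          Finset.sum_le_sum fun v hv => (lt_card_of_pred hf hv).le
      _ = S.card * S.card := by simp
  obtain ⟨f, hf, hsum⟩ := Nat.sSup_mem hne hbd
  refine ⟨f, hf, ?_⟩
  intro u hu v hv huv
  by_contra! hcon
  obtain ⟨hle, hnr⟩ := hcon
  let R : V → V → Prop := fun a b => a ∈ S ∧ b ∈ S ∧ D a b ∧ f b = f a + 1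
  let g : V → ℕ := fun w => if Relation.ReflTransGen R v w then f w + (f u + 1 - f v) else f w
  have hgR : ∀ w, Relation.ReflTransGen R v w → g w = f w + (f u + 1 - f v) :=
    fun w hw => if_pos hw
  have hgN : ∀ w, ¬ Relation.ReflTransGen R v w → g w = f w := fun w hw => if_neg hw
  have hg : P g := by
    intro w hw hw0
    by_cases hr : Relation.ReflTransGen R v w
    · rcases Relation.ReflTransGen.cases_tail hr with h | ⟨z, hz, hzw⟩
      · subst h
        exact ⟨u, hu, huv, by rw [hgN u hnr, hgR _ hr]; omega⟩
      · refine ⟨z, hzw.1, hzw.2.2.1, ?_⟩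
        rw [hgR z hz, hgR w hr, hzw.2.2.2]
        omega
    · rw [hgN w hr] at hw0 ⊢
      obtain ⟨z, hz, hzw, h1⟩ := hf w hw hw0
      refine ⟨z, hz, hzw, ?_⟩
      rw [hgN z fun hvz => hr (hvz.tail ⟨hz, hw, hzw, h1.symm⟩), h1]
  have hlt : ∑ w ∈ S, f w < ∑ w ∈ S, g w := by
    refine Finset.sum_lt_sum (fun w _ => ?_) ⟨v, hv, ?_⟩
    · by_cases hr : Relation.ReflTransGen R v w
      · rw [hgR w hr]; omega
      · rw [hgN w hr]
    · rw [hgR v Relation.ReflTransGen.refl]; omega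
  have := le_csSup hbd (⟨g, hg, rfl⟩ : ∑ w ∈ S, g w ∈ A)
  omega

theorem IsLevel.path_to {D : V → V → Prop} {S : Finset V} {f : V → ℕ} (hf : IsLevel D S f)
    (m : ℕ) : ∀ v ∈ S, m ≤ f v →
      ∃ p, IsDPath D S p m ∧ p m = v ∧ ∀ i ≤ m, f (p i) + m = f v + i := by
  induction m with
  | zero =>
    intro v hv _
    exact ⟨fun _ => v, ⟨fun _ _ => hv, fun i hi => absurd hi (Nat.not_lt_zero i),
      fun i hi j hj _ => by omega⟩, rfl, fun i hi => by simp; omega⟩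
  | succ m ih =>
    intro v hv hm
    obtain ⟨u, hu, huv, h1⟩ := hf.pred v hv (by omega)
    obtain ⟨p, hp, hpm, hpf⟩ := ih u hu (by omega)
    refine ⟨_, hp.snoc hv (by rwa [hpm]) ?_, by simp, ?_⟩
    · intro i hi h
      have := hpf i hi
      rw [h] at this
      omega
    · intro i hi
      by_cases h : i ≤ m
      · have := hpf i h
        simp only [h, if_true]; omega
      · simp only [h, if_false]; omega

theorem path_of_reflTransGen {D : V → V → Prop} {S : Finset V} {f : V → ℕ} {v u : V} (hv : v ∈ S)
    (h : Relation.ReflTransGen (fun a b => a ∈ S ∧ b ∈ S ∧ D a b ∧ f b = f a + 1) v u) :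
    ∃ p m, IsDPath D S p m ∧ p m = u ∧ f u = f v + m ∧ ∀ i ≤ m, f (p i) = f v + i := by
  induction h with
  | refl =>
    exact ⟨fun _ => v, 0, ⟨fun _ _ => hv, fun i hi => absurd hi (Nat.not_lt_zero i),
      fun i hi j hj _ => by omega⟩, rfl, rfl, fun i hi => by simp; omega⟩
  | tail _ hbc ih =>
    obtain ⟨p, m, hp, hpm, hm, hpf⟩ := ih
    obtain ⟨_, hc, hD, h1⟩ := hbc
    refine ⟨_, m + 1, hp.snoc hc (by rwa [hpm]) ?_, by simp, by omega, ?_⟩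
    · intro i hi h
      have := hpf i hi
      rw [h] at this
      omega
    · intro i hi
      by_cases h : i ≤ m
      · simp only [h, if_true]; exact hpf i h
      · simp only [h, if_false]; omega

theorem IsLevel.ne {D : V → V → Prop} {S : Finset V} {f : V → ℕ} (hf : IsLevel D S f)
    (hirr : ∀ v, ¬ D v v) {u v : V} (hu : u ∈ S) (hv : v ∈ S) (h : D u v) : f u ≠ f v := by
  rcases hf.arc u hu v hv h with h1 | h1
  · omega
  · intro he
    rcases Relation.ReflTransGen.cases_tail h1 with h2 | ⟨z, hz, hzu⟩
    · exact hirr v (h2 ▸ h)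
    · obtain ⟨_, m, _, _, h3, _⟩ := path_of_reflTransGen hv hz
      have := hzu.2.2.2
      omega

/-- Gallai–Roy. -/
theorem col_of_no_path {D : V → V → Prop} (hirr : ∀ v, ¬ D v v) {S : Finset V} {m : ℕ}
    (h : ∀ p, ¬ IsDPath D S p m) : Col D S m := by
  obtain ⟨f, hf⟩ := exists_isLevel D S
  refine ⟨f, fun v hv => ?_, fun u hu v hv => hf.ne hirr hu hv⟩
  by_contra! hm
  obtain ⟨p, hp, _⟩ := hf.path_to m v hv hm
  exact h p hp

theorem IsLevel.sinkPair_of_climb {D : V → V → Prop} {S : Finset V} {f : V → ℕ}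
    (hf : IsLevel D S f) {u v : V} (hu : u ∈ S) (hv : v ∈ S) (h : D u v) {a b : ℕ}
    (ha : a ≤ f u) (hb : f u + b < f v) : SinkPair D S (a + 1) b := by
  obtain ⟨p, hp, hpa, hpf⟩ := hf.path_to a u hu ha
  obtain ⟨q, hq, hqb, hqf⟩ := hf.path_to b v hv (by omega)
  refine ⟨_, q, hp.snoc hv (by rwa [hpa]) ?_, hq, by simp [hqb], ?_⟩
  · intro i hi he
    have := hpf i hi
    rw [he] at this
    omega
  · intro i hi j hj
    have h1 : i ≤ a := by omega
    simp only [h1, if_true]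
    intro he
    have h2 := hpf i h1
    have h3 := hqf j hj.le
    rw [he] at h2
    omega

theorem IsLevel.sinkPair_of_drop {D : V → V → Prop} {S : Finset V} {f : V → ℕ}
    (hf : IsLevel D S f) {u v : V} (hu : u ∈ S) (hv : v ∈ S) (h : D u v) {a b : ℕ}
    (ha : a ≤ f v) (hb : f v + b < f u) : SinkPair D S a (b + 1) := by
  obtain ⟨p, hp, hpa, hpf⟩ := hf.path_to a v hv ha
  obtain ⟨q, m, hq, hqm, hm, hqf⟩ :=
    path_of_reflTransGen hv ((hf.arc u hu v hv h).resolve_left (by omega))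
  have hq' := hq.sub (m - b) b (by omega)
  have hlast : m - b + b = m := by omega
  refine ⟨p, _, hp, hq'.snoc hv (by simpa only [hlast, hqm] using h) ?_, by simp [hpa], ?_⟩
  · intro i hi he
    have := hqf (m - b + i) (by omega)
    rw [he] at this
    omega
  · intro i hi j hj
    have h1 : j ≤ b := by omega
    simp only [h1, if_true]
    intro he
    have h2 := hpf i hi.le
    have h3 := hqf (m - b + j) (by omega)
    rw [he] at h2
    omega

theorem col_of_no_sinkPair {D : V → V → Prop} (hirr : ∀ v, ¬ D v v) {S : Finset V} {a b : ℕ}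
    (ha : 1 ≤ a) (hb : 1 ≤ b) (h : ¬ SinkPair D S a b) : Col D S (a + b + 1) := by
  obtain ⟨f, hf⟩ := exists_isLevel D S
  have hmod : ∀ n, n % (b + 1) < b + 1 := fun n => Nat.mod_lt _ (by omega)
  refine ⟨fun v => if f v < a then f v else a + f v % (b + 1), fun v _ => ?_,
    fun u hu v hv huv => ?_⟩
  · have := hmod (f v)
    dsimp only
    split_ifs <;> omega
  have hne := hf.ne hirr hu hv huv
  dsimp only
  split_ifs with h1 h2 h2
  · exact hne
  · omega
  · omega
  · intro he
    have he' : f u % (b + 1) = f v % (b + 1) := by omega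
    rcases Nat.lt_or_gt_of_ne hne with hlt | hlt
    · have h3 := Nat.le_of_dvd (by omega) ((Nat.modEq_iff_dvd' hlt.le).mp he')
      obtain ⟨a, rfl⟩ : ∃ a', a = a' + 1 := ⟨a - 1, by omega⟩
      exact h (hf.sinkPair_of_climb hu hv huv (by omega) (by omega))
    · have h3 := Nat.le_of_dvd (by omega) ((Nat.modEq_iff_dvd' hlt.le).mp he'.symm)
      obtain ⟨b, rfl⟩ : ∃ b', b = b' + 1 := ⟨b - 1, by omega⟩
      exact h (hf.sinkPair_of_drop hu hv huv (by omega) (by omega))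

theorem col_three_of_no_sinkPair {D : V → V → Prop} (hirr : ∀ v, ¬ D v v) {S : Finset V}
    (h : ¬ SinkPair D S 2 1) : Col D S 3 := by
  obtain ⟨f, hf⟩ := exists_isLevel D S
  refine ⟨fun v => if f v = 0 then 0 else 1 + f v % 2, fun v _ => ?_,
    fun u hu v hv huv => ?_⟩
  · dsimp only
    split_ifs <;> omega
  have hne := hf.ne hirr hu hv huv
  dsimp only
  split_ifs with h1 h2 h2
  · omega
  · omega
  · omega
  · intro he
    rcases Nat.lt_or_gt_of_ne hne with hlt | hlt
    · exact h (hf.sinkPair_of_climb (a := 1) hu hv huv (by omega) (by omega))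
    · exact h (hf.sinkPair_of_drop (b := 1) hu hv huv (a := 1) (by omega) (by omega)).symm

/-- A two-block path all of whose vertices end a `k`-arc path coming from outside extends to a
three-block path. -/
theorem hasP3_of_sinkPair {D : V → V → Prop} {X C : Finset V} {k l r : ℕ}
    (hdisj : Disjoint X C)
    (hC : ∀ v ∈ C, ∃ p : ℕ → V, (∀ i < k, p i ∈ X) ∧ (∀ i < k, D (p i) (p (i + 1))) ∧
      (∀ i ≤ k, ∀ j ≤ k, p i = p j → i = j) ∧ p k = v)
    (h : SinkPair (flip D) C l r) : HasP3 D k l r := by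
  obtain ⟨b, c, hb, hc, hbc, hd⟩ := h
  obtain ⟨a, haX, haD, hai, hak⟩ := hC (b 0) (hb.mem 0 (by omega))
  have hXC : ∀ u ∈ X, ∀ v ∈ C, u ≠ v := fun u hu v hv he =>
    Finset.disjoint_left.mp hdisj hu (he ▸ hv)
  let x : ℕ → V := fun i => if i < k then a i else if i ≤ k + l then b (i - k)
    else c (k + l + r - i)
  have x1 : ∀ i, i ≤ k → x i = a i := by
    intro i hi
    rcases hi.lt_or_eq with h | rfl
    · simp [x, h]
    · simp [x, hak]
  have x2 : ∀ i, k ≤ i → i ≤ k + l → x i = b (i - k) := by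
    intro i h1 h2
    simp [x, h2, show ¬ i < k by omega]
  have x3 : ∀ i, k + l ≤ i → i ≤ k + l + r → x i = c (k + l + r - i) := by
    intro i h1 h2
    rcases h1.lt_or_eq with h | rfl
    · simp [x, show ¬ i < k by omega, show ¬ i ≤ k + l by omega]
    · simp [x, hbc]
  have key : ∀ i j, i < j → j ≤ k + l + r → x i ≠ x j := by
    intro i j hij hj he
    rcases Nat.lt_or_ge i k with h1 | h1
    · rcases Nat.lt_or_ge j k with h2 | h2
      · rw [x1 i h1.le, x1 j h2.le] at he
        have := hai i h1.le j h2.le he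
        omega
      rw [x1 i h1.le] at he
      rcases Nat.lt_or_ge (k + l) j with h3 | h3
      · rw [x3 j h3.le hj] at he
        exact hXC _ (haX i h1) _ (hc.mem _ (by omega)) he
      · rw [x2 j h2 h3] at he
        exact hXC _ (haX i h1) _ (hb.mem _ (by omega)) he
    rcases Nat.lt_or_ge i (k + l) with h2 | h2
    · rw [x2 i h1 h2.le] at he
      rcases Nat.lt_or_ge (k + l) j with h3 | h3
      · rw [x3 j h3.le hj] at he
        exact hd _ (by omega) _ (by omega) he
      · rw [x2 j (by omega) h3] at he
        have := hb.inj _ (by omega) _ (by omega) he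
        omega
    · rw [x3 i h2 (by omega), x3 j (by omega) hj] at he
      have := hc.inj _ (by omega) _ (by omega) he
      omega
  refine ⟨x, ?_, ?_, ?_, ?_⟩
  · intro i hi j hj he
    rcases lt_trichotomy i j with h | h | h
    · exact absurd he (key i j h hj)
    · exact h
    · exact absurd he.symm (key j i h hi)
  · intro i hi
    rw [x1 i hi.le, x1 (i + 1) hi]
    exact haD i hi
  · intro i h1 h2
    rw [x2 i h1 h2.le, x2 (i + 1) (by omega) h2, show i + 1 - k = i - k + 1 by omega]
    exact hb.arc (i - k) (by omega)
  · intro i h1 h2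
    rw [x3 i h1 h2.le, x3 (i + 1) (by omega) h2,
      show k + l + r - i = k + l + r - (i + 1) + 1 by omega]
    exact hc.arc _ (by omega)

/-- A digraph without `P(k,l,r)` splits into a set without long directed paths and two sets
without suitable two-block paths. -/
theorem exists_split [Fintype V] {D : V → V → Prop} {k l r : ℕ} (hk : 1 ≤ k) (hr : 1 ≤ r)
    (h : ¬ HasP3 D k l r) : ∃ X A B : Finset V, (∀ p, ¬ IsDPath D X p (k + r - 1)) ∧
      ¬ SinkPair (flip D) A l r ∧ ¬ SinkPair D B l k ∧ ∀ v, v ∈ X ∨ v ∈ A ∨ v ∈ B := by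
  classical
  obtain ⟨X, hX, hmax⟩ := Finset.exists_max_image
    (Finset.univ.filter fun X : Finset V => ∀ p, ¬ IsDPath D X p (k + r - 1)) Finset.card
    ⟨∅, by
      simp only [Finset.mem_filter, Finset.mem_univ, true_and]
      intro p hp
      exact absurd (hp.mem 0 (by omega)) (Finset.notMem_empty _)⟩
  simp only [Finset.mem_filter, Finset.mem_univ, true_and] at hX hmax
  let A := Finset.univ.filter fun v => v ∉ X ∧ ∃ p : ℕ → V, (∀ i < k, p i ∈ X) ∧
    (∀ i < k, D (p i) (p (i + 1))) ∧ (∀ i ≤ k, ∀ j ≤ k, p i = p j → i = j) ∧ p k = v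
  let B := Finset.univ.filter fun v => v ∉ X ∧ ∃ p : ℕ → V, (∀ i < r, p i ∈ X) ∧
    (∀ i < r, flip D (p i) (p (i + 1))) ∧ (∀ i ≤ r, ∀ j ≤ r, p i = p j → i = j) ∧ p r = v
  refine ⟨X, A, B, hX, ?_, ?_, ?_⟩
  · intro hA
    refine h (hasP3_of_sinkPair (X := X) (C := A) ?_ ?_ hA)
    · rw [Finset.disjoint_right]
      intro v hv
      exact (Finset.mem_filter.mp hv).2.1
    · intro v hv
      exact (Finset.mem_filter.mp hv).2.2
  · intro hB
    refine h (HasP3.of_flip (hasP3_of_sinkPair (X := X) (C := B) ?_ ?_ hB))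
    · rw [Finset.disjoint_right]
      intro v hv
      exact (Finset.mem_filter.mp hv).2.1
    · intro v hv
      exact (Finset.mem_filter.mp hv).2.2
  · intro v
    by_cases hv : v ∈ X
    · exact Or.inl hv
    right
    have hins : ¬ ∀ p, ¬ IsDPath D (insert v X) p (k + r - 1) := by
      intro hcon
      have := hmax _ hcon
      rw [Finset.card_insert_of_notMem hv] at this
      omega
    push Not at hins
    obtain ⟨p, hp⟩ := hins
    obtain ⟨j, hj, hjv⟩ : ∃ j ≤ k + r - 1, p j = v := by
      by_contra! hcon
      refine hX p ⟨fun i hi => ?_, hp.arc, hp.inj⟩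
      exact (Finset.mem_insert.mp (hp.mem i hi)).resolve_left (hcon i hi)
    have hmem : ∀ i ≤ k + r - 1, i ≠ j → p i ∈ X := by
      intro i hi hij
      refine (Finset.mem_insert.mp (hp.mem i hi)).resolve_left fun he => hij ?_
      exact hp.inj i hi j hj (he.trans hjv.symm)
    rcases Nat.lt_or_ge j k with hjk | hjk
    · right
      refine Finset.mem_filter.mpr ⟨Finset.mem_univ _, hv, fun i => p (j + r - i), ?_, ?_, ?_, ?_⟩
      · intro i hi
        exact hmem _ (by omega) (by omega)
      · intro i hi
        have := hp.arc (j + r - (i + 1)) (by omega)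
        rwa [show j + r - (i + 1) + 1 = j + r - i by omega] at this
      · intro i hi i' hi' he
        have := hp.inj _ (by omega) _ (by omega) he
        omega
      · simpa using hjv
    · left
      refine Finset.mem_filter.mpr ⟨Finset.mem_univ _, hv, fun i => p (j - k + i), ?_, ?_, ?_, ?_⟩
      · intro i hi
        exact hmem _ (by omega) (by omega)
      · intro i hi
        exact hp.arc (j - k + i) (by omega)
      · intro i hi i' hi' he
        have := hp.inj _ (by omega) _ (by omega) he
        omega
      · simpa only [show j - k + k = j by omega] using hjv

theorem col_general [Fintype V] {D : V → V → Prop} (hirr : ∀ v, ¬ D v v) {k l r : ℕ}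
    (hk : 1 ≤ k) (hl : 1 ≤ l) (hr : 1 ≤ r) (h : ¬ HasP3 D k l r) :
    Col D Finset.univ (2 * (k + l + r) + 1) := by
  classical
  obtain ⟨X, A, B, hX, hA, hB, hcov⟩ := exists_split hk hr h
  have h1 := col_of_no_path hirr hX
  have h2 := (col_of_no_sinkPair (D := flip D) hirr hl hr hA).of_flip
  have h3 := col_of_no_sinkPair hirr hl hk hB
  refine (h1.cover (h2.cover h3 (S := A ∪ B) fun v => Finset.mem_union.mp)
    fun v _ => ?_).mono (by omega)
  simpa using hcov v

theorem col_one_two_one [Fintype V] {D : V → V → Prop} (hirr : ∀ v, ¬ D v v)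
    (h : ¬ HasP3 D 1 2 1) : Col D Finset.univ 7 := by
  classical
  obtain ⟨X, A, B, hX, hA, hB, hcov⟩ := exists_split le_rfl le_rfl h
  have h1 := col_of_no_path hirr hX
  have h2 := (col_three_of_no_sinkPair (D := flip D) hirr hA).of_flip
  have h3 := col_three_of_no_sinkPair hirr hB
  refine (h1.cover (h2.cover h3 (S := A ∪ B) fun v => Finset.mem_union.mp)
    fun v _ => ?_).mono (by omega)
  simpa using hcov v

open Classical in
/-- The number of in-neighbours of `v` in `S`. -/
noncomputable def inDeg (D : V → V → Prop) (S : Finset V) (v : V) : ℕ :=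
  (S.filter fun u => D u v).card

theorem exists_notMem_of_card_lt {D : V → V → Prop} {S : Finset V} {v : V} (F : Finset V)
    (h : F.card < inDeg D S v) : ∃ u ∈ S, D u v ∧ u ∉ F := by
  classical
  obtain ⟨u, hu, huF⟩ := Finset.exists_mem_notMem_of_card_lt_card h
  obtain ⟨h1, h2⟩ := Finset.mem_filter.mp hu
  exact ⟨u, h1, h2, huF⟩

theorem inDeg_le_card {D : V → V → Prop} {S : Finset V} {v : V} (F : Finset V)
    (h : ∀ u ∈ S, D u v → u ∈ F) : inDeg D S v ≤ F.card := by
  by_contra! hlt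
  obtain ⟨u, hu, huv, hF⟩ := exists_notMem_of_card_lt F hlt
  exact hF (h u hu huv)

theorem inDeg_mono {D E : V → V → Prop} {S T : Finset V} {v : V} (hST : S ⊆ T)
    (h : ∀ u ∈ S, D u v → E u v) : inDeg D S v ≤ inDeg E T v := by
  classical
  refine Finset.card_le_card fun u hu => ?_
  obtain ⟨h1, h2⟩ := Finset.mem_filter.mp hu
  exact Finset.mem_filter.mpr ⟨hST h1, h u h1 h2⟩

/-- A digraph is `d`-colourable once all its induced subdigraphs of minimum degree at least `d`
are. -/
theorem col_of_minDeg {D : V → V → Prop} (hirr : ∀ v, ¬ D v v) {d : ℕ} (S : Finset V)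
    (h : ∀ S' ⊆ S, (∀ v ∈ S', d ≤ inDeg D S' v + inDeg (flip D) S' v) → Col D S' d) :
    Col D S d := by
  classical
  induction S using Finset.strongInduction with
  | H S ih =>
    by_cases hmin : ∀ v ∈ S, d ≤ inDeg D S v + inDeg (flip D) S v
    · exact h S subset_rfl hmin
    push Not at hmin
    obtain ⟨v, hv, hd⟩ := hmin
    obtain ⟨c, h1, h2⟩ := ih (S.erase v) (Finset.erase_ssubset hv)
      fun S' hS' => h S' (hS'.trans (Finset.erase_subset _ _))
    let N := (S.filter fun u => D u v) ∪ (S.filter fun u => flip D u v)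
    have hN : (N.image c).card < (Finset.range d).card := by
      rw [Finset.card_range]
      refine (Finset.card_image_le.trans (Finset.card_union_le _ _)).trans_lt ?_
      convert hd using 2 <;> unfold inDeg <;> congr
    obtain ⟨a, ha, haN⟩ := Finset.exists_mem_notMem_of_card_lt_card hN
    have hav : ∀ u ∈ S, D u v ∨ D v u → c u ≠ a := by
      rintro u hu huv rfl
      refine haN (Finset.mem_image_of_mem c (Finset.mem_union.mpr ?_))
      exact huv.imp (fun h => Finset.mem_filter.mpr ⟨hu, h⟩)
        fun h => Finset.mem_filter.mpr ⟨hu, h⟩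
    refine ⟨Function.update c v a, fun u hu => ?_, fun u hu w hw huw => ?_⟩
    · rcases eq_or_ne u v with rfl | hne
      · simpa using ha
      · simpa [hne] using h1 u (Finset.mem_erase.mpr ⟨hne, hu⟩)
    · by_cases hu' : u = v <;> by_cases hw' : w = v
      · exact absurd (hu'.trans hw'.symm ▸ huw : D w w) (hirr w)
      · rw [hu', Function.update_self, Function.update_of_ne hw']
        exact (hav w hw (Or.inr (hu' ▸ huw))).symm
      · rw [hw', Function.update_self, Function.update_of_ne hu']
        exact hav u hu (Or.inl (hw' ▸ huw))
      · rw [Function.update_of_ne hu', Function.update_of_ne hw']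
        exact h2 u (Finset.mem_erase.mpr ⟨hu', hu⟩) w (Finset.mem_erase.mpr ⟨hw', hw⟩) huw

/-- If every arc of `D` inside `S` can be charged to one of its ends, each vertex being charged at
most `c` times, then `D` is `(2 * c + 1)`-colourable on `S`. -/
theorem col_of_charge {D : V → V → Prop} (hasym : ∀ u v, D u v → ¬ D v u) {c : ℕ} {S : Finset V}
    (E : V → V → Prop) (hE : ∀ u ∈ S, ∀ v ∈ S, D u v → E u v ∨ E v u)
    (hc : ∀ v ∈ S, inDeg E S v ≤ c) : Col D S (2 * c + 1) := by
  classical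
  refine col_of_minDeg (fun v hv => hasym v v hv hv) S fun S' hS' hmin => ?_
  have hswap : ∀ R : V → V → Prop, ∑ v ∈ S', inDeg R S' v = ∑ v ∈ S', inDeg (flip R) S' v := by
    intro R
    exact Finset.sum_card_bipartiteAbove_eq_sum_card_bipartiteBelow (fun a b => R b a)
  have hle : ∑ v ∈ S', (inDeg D S' v + inDeg (flip D) S' v) ≤
      ∑ v ∈ S', (inDeg E S' v + inDeg (flip E) S' v) := by
    refine Finset.sum_le_sum fun v hv => ?_
    unfold inDeg
    have hdis : Disjoint (S'.filter fun u => D u v) (S'.filter fun u => flip D u v) :=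
      Finset.disjoint_filter.mpr fun u _ h => hasym u v h
    rw [← Finset.card_union_of_disjoint (by convert hdis)]
    refine (Finset.card_le_card ?_).trans (Finset.card_union_le _ _)
    rw [← Finset.filter_or, ← Finset.filter_or]
    intro u hu
    obtain ⟨h1, h2⟩ := Finset.mem_filter.mp hu
    refine Finset.mem_filter.mpr ⟨h1, ?_⟩
    rcases h2 with h2 | h2
    · exact hE u (hS' h1) v (hS' hv) h2
    · exact (hE v (hS' hv) u (hS' h1) h2).symm
  have hEc : ∑ v ∈ S', inDeg E S' v ≤ S'.card * c := by
    rw [← smul_eq_mul]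
    exact Finset.sum_le_card_nsmul _ _ _ fun v hv =>
      (inDeg_mono hS' fun _ _ h => h).trans (hc v (hS' hv))
  have hlow : S'.card * (2 * c + 1) ≤ ∑ v ∈ S', (inDeg D S' v + inDeg (flip D) S' v) := by
    rw [← smul_eq_mul]
    exact Finset.card_nsmul_le_sum _ _ _ hmin
  have hempty : S' = ∅ := by
    rw [Finset.sum_add_distrib (f := inDeg E S'), ← hswap E] at hle
    rw [← Finset.card_eq_zero]
    nlinarith
  subst hempty
  exact ⟨fun _ => 0, by simp, by simp⟩

theorem hasP3_one_one_one {D : V → V → Prop} {a b c d : V} (hab : D a b) (hcb : D c b)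
    (hcd : D c d) (hn : [a, b, c, d].Nodup) : HasP3 D 1 1 1 := by
  refine ⟨fun i => [a, b, c, d].getD i a, ?_, ?_, ?_, ?_⟩
  · intro i hi j hj h
    dsimp only at h
    rw [List.getD_eq_getElem _ _ (by simp; omega), List.getD_eq_getElem _ _ (by simp; omega)] at h
    exact (hn.getElem_inj_iff).mp h
  · intro i hi
    obtain rfl : i = 0 := by omega
    exact hab
  · intro i h1 h2
    obtain rfl : i = 1 := by omega
    exact hcb
  · intro i h1 h2
    obtain rfl : i = 2 := by omega
    exact hcd

theorem hasP3_two_one_one {D : V → V → Prop} {a b c d e : V} (hab : D a b) (hbc : D b c)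
    (hdc : D d c) (hde : D d e) (hn : [a, b, c, d, e].Nodup) : HasP3 D 2 1 1 := by
  refine ⟨fun i => [a, b, c, d, e].getD i a, ?_, ?_, ?_, ?_⟩
  · intro i hi j hj h
    dsimp only at h
    rw [List.getD_eq_getElem _ _ (by simp; omega), List.getD_eq_getElem _ _ (by simp; omega)] at h
    exact (hn.getElem_inj_iff).mp h
  · intro i hi
    interval_cases i
    · exact hab
    · exact hbc
  · intro i h1 h2
    obtain rfl : i = 2 := by omega
    exact hdc
  · intro i h1 h2
    obtain rfl : i = 3 := by omega
    exact hde

theorem col_one_one_one {D : V → V → Prop} (hasym : ∀ u v, D u v → ¬ D v u) {S : Finset V}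
    (h : ¬ HasP3 D 1 1 1) : Col D S 3 := by
  classical
  have hirr : ∀ v, ¬ D v v := fun v hv => hasym v v hv hv
  have hne : ∀ u v, D u v → u ≠ v := fun u v huv he => hirr v (he ▸ huv)
  refine col_of_minDeg hirr S fun S' _ hmin => ?_
  have key : ∀ s ∈ S', ∀ t ∈ S', D s t → inDeg D S' t ≤ 1 ∨ inDeg (flip D) S' s ≤ 1 := by
    intro s hs t ht hst
    by_contra! hcon
    obtain ⟨h1, h2⟩ := hcon
    obtain ⟨u, hu, hut, hus⟩ := exists_notMem_of_card_lt {s} (by simpa using h1)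
    obtain ⟨w, hw, hsw, hwt⟩ := exists_notMem_of_card_lt {t} (by simpa using h2)
    simp only [Finset.mem_singleton] at hus hwt
    rcases eq_or_ne u w with rfl | huw
    · change D s u at hsw
      rcases (show 2 ≤ inDeg D S' u ∨ 2 ≤ inDeg (flip D) S' u by have := hmin u hu; omega)
        with h3 | h3
      · obtain ⟨z, hz, hzu, hzs⟩ := exists_notMem_of_card_lt {s}
          ((Finset.card_singleton _).trans_lt h3)
        simp only [Finset.mem_singleton] at hzs
        refine h (hasP3_one_one_one hzu hsw hst ?_)
        have : z ≠ t := by rintro rfl; exact hasym _ _ hzu hut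
        have := hne _ _ hzu
        have := hne _ _ hst
        simp; tauto
      · obtain ⟨z, hz, huz, hzt⟩ := exists_notMem_of_card_lt {t}
          ((Finset.card_singleton _).trans_lt h3)
        simp only [Finset.mem_singleton] at hzt
        change D u z at huz
        refine h (hasP3_one_one_one hst hut huz ?_)
        have : z ≠ s := by rintro rfl; exact hasym _ _ huz hsw
        have := hne _ _ huz
        have := hne _ _ hst
        grind
    · change D s w at hsw
      refine h (hasP3_one_one_one hut hst hsw ?_)
      have := hne _ _ hut
      have := hne _ _ hst
      have := hne _ _ hsw
      grind
  refine col_of_charge (c := 1) hasym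
    (fun u v => (inDeg D S' v ≤ 1 ∧ D u v) ∨ (inDeg (flip D) S' v ≤ 1 ∧ D v u)) ?_ ?_
  · intro u hu v hv huv
    exact (key u hu v hv huv).imp (fun h => Or.inl ⟨h, huv⟩) fun h => Or.inr ⟨h, huv⟩
  · intro v hv
    have := hmin v hv
    by_cases h1 : inDeg D S' v ≤ 1
    · refine (inDeg_mono subset_rfl fun u _ huv => ?_).trans h1
      rcases huv with h2 | h2
      · exact h2.2
      · omega
    · by_cases h2 : inDeg (flip D) S' v ≤ 1
      · refine (inDeg_mono subset_rfl fun u _ huv => ?_).trans h2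
        rcases huv with h3 | h3
        · exact absurd h3.1 h1
        · exact h3.2
      · refine (inDeg_le_card ∅ fun u _ huv => ?_).trans (by simp)
        rcases huv with h3 | h3
        · exact absurd h3.1 h1
        · exact absurd h3.1 h2

theorem col_two_one_one {D : V → V → Prop} (hasym : ∀ u v, D u v → ¬ D v u) {S : Finset V}
    (h : ¬ HasP3 D 2 1 1) : Col D S 7 := by
  classical
  have hirr : ∀ v, ¬ D v v := fun v hv => hasym v v hv hv
  have hne : ∀ u v, D u v → u ≠ v := fun u v huv he => hirr v (he ▸ huv)
  refine col_of_minDeg hirr S fun S' _ hmin => ?_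
  have key : ∀ s ∈ S', ∀ t ∈ S', ∀ x ∈ S', D s t → D x t → x ≠ s → 2 ≤ inDeg D S' x →
      inDeg (flip D) S' s ≤ 2 := by
    intro s hs t ht x hx hst hxt hxs hxin
    by_contra! hout
    have hsub : ∀ y ∈ S', D y x → y ≠ s → ∀ z ∈ S', D s z → z ∈ ({t, x, y} : Finset V) := by
      intro y hy hyx hys z hz hsz
      by_contra hzn
      simp only [Finset.mem_insert, Finset.mem_singleton, not_or] at hzn
      refine h (hasP3_two_one_one hyx hxt hst hsz ?_)
      have : y ≠ t := by rintro rfl; exact hasym _ _ hyx hxt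
      have := hne _ _ hyx
      have := hne _ _ hxt
      have := hne _ _ hst
      have := hne _ _ hsz
      grind
    obtain ⟨y, hy, hyx, hys⟩ := exists_notMem_of_card_lt {s}
      ((Finset.card_singleton _).trans_lt hxin)
    simp only [Finset.mem_singleton] at hys
    have hs3 : inDeg (flip D) S' s ≤ 3 :=
      (inDeg_le_card _ (hsub y hy hyx hys)).trans Finset.card_le_three
    have hsx : D s x := by
      by_contra hsx
      have h2 : inDeg (flip D) S' s ≤ ({t, y} : Finset V).card := by
        refine inDeg_le_card _ fun z hz hsz => ?_
        have h3 := hsub y hy hyx hys z hz hsz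
        have : z ≠ x := by rintro rfl; exact hsx hsz
        simp only [Finset.mem_insert, Finset.mem_singleton] at h3 ⊢
        tauto
      have := Finset.card_le_two (a := t) (b := y)
      omega
    have hx2 : inDeg D S' x ≤ ({s, y} : Finset V).card := by
      refine inDeg_le_card _ fun z hz hzx => ?_
      by_contra hzn
      simp only [Finset.mem_insert, Finset.mem_singleton, not_or] at hzn
      have h2 : inDeg (flip D) S' s ≤ ({t, x} : Finset V).card := by
        refine inDeg_le_card _ fun w hw hsw => ?_
        have h3 := hsub y hy hyx hys w hw hsw
        have h4 := hsub z hz hzx hzn.1 w hw hsw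
        simp only [Finset.mem_insert, Finset.mem_singleton] at h3 h4 ⊢
        grind
      have := Finset.card_le_two (a := t) (b := x)
      omega
    have := Finset.card_le_two (a := s) (b := y)
    have := hmin s hs
    have := hmin x hx
    obtain ⟨w, hw, hws, -⟩ := exists_notMem_of_card_lt (D := D) (S := S') (v := s) ∅
      (by simp; omega)
    have hc3 : ({t, s, w} : Finset V).card ≤ 3 := Finset.card_le_three
    obtain ⟨z, hz, hxz, hzn⟩ := exists_notMem_of_card_lt (D := flip D) (S := S') (v := x)
      {t, s, w} (by omega)
    change D x z at hxz
    simp only [Finset.mem_insert, Finset.mem_singleton, not_or] at hzn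
    refine h (hasP3_two_one_one hws hst hxt hxz ?_)
    have : w ≠ t := by rintro rfl; exact hasym _ _ hws hst
    have : w ≠ x := by rintro rfl; exact hasym _ _ hws hsx
    have := hne _ _ hws
    have := hne _ _ hxt
    have := hne _ _ hst
    have := hne _ _ hxz
    grind
  let Z := S'.filter fun t => 2 ≤ inDeg D S' t ∧ ∀ u ∈ S', D u t → inDeg D S' u ≤ 1
  have hZ : Col D Z 1 := by
    refine ⟨fun _ => 0, fun _ _ => one_pos, fun u hu v hv huv => ?_⟩
    obtain ⟨h1, h2, -⟩ := Finset.mem_filter.mp hu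
    have := (Finset.mem_filter.mp hv).2.2 u h1 huv
    omega
  have hR : Col D (S' \ Z) (2 * 2 + 1) := by
    refine col_of_charge hasym (fun u v => (inDeg D S' v ≤ 1 ∧ D u v) ∨
      (2 ≤ inDeg D S' v ∧ inDeg (flip D) S' v ≤ 2 ∧ D v u)) ?_ ?_
    · intro u hu t ht hut
      have hu' := (Finset.mem_sdiff.mp hu).1
      obtain ⟨ht', htZ⟩ := Finset.mem_sdiff.mp ht
      by_cases h1 : inDeg D S' t ≤ 1
      · exact Or.inl (Or.inl ⟨h1, hut⟩)
      have h2 : ∃ x ∈ S', D x t ∧ 2 ≤ inDeg D S' x := by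
        by_contra! hcon
        exact htZ (Finset.mem_filter.mpr ⟨ht', by omega, fun x hx hxt => by
          have := hcon x hx hxt
          omega⟩)
      obtain ⟨x, hx, hxt, hx2⟩ := h2
      have hout : inDeg (flip D) S' u ≤ 2 := by
        rcases eq_or_ne x u with rfl | hxu
        · obtain ⟨y, hy, hyt, hyx⟩ := exists_notMem_of_card_lt (D := D) (S := S') (v := t) {x}
            (by simp; omega)
          simp only [Finset.mem_singleton] at hyx
          have h3 := key y hy t ht' x hx hyt hxt (Ne.symm hyx) hx2
          have := hmin y hy
          exact key x hx t ht' y hy hxt hyt hyx (by omega)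
        · exact key u hu' t ht' x hx hut hxt hxu hx2
      have := hmin u hu'
      exact Or.inr (Or.inr ⟨by omega, hout, hut⟩)
    · intro v hv
      by_cases h1 : inDeg D S' v ≤ 1
      · refine ((inDeg_mono Finset.sdiff_subset fun u _ huv => ?_).trans h1).trans one_le_two
        rcases huv with h2 | h2
        · exact h2.2
        · omega
      · by_cases h2 : inDeg (flip D) S' v ≤ 2
        · refine (inDeg_mono Finset.sdiff_subset fun u _ huv => ?_).trans h2
          rcases huv with h3 | h3
          · exact absurd h3.1 h1
          · exact h3.2.2
        · refine (inDeg_le_card ∅ fun u _ huv => ?_).trans (by simp)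
          rcases huv with h3 | h3
          · exact absurd h3.1 h1
          · exact absurd h3.2.1 h2
  refine (hZ.cover hR fun v hv => ?_).mono (by omega)
  by_cases hvZ : v ∈ Z
  · exact Or.inl hvZ
  · exact Or.inr (Finset.mem_sdiff.mpr ⟨hv, hvZ⟩)

/-- Every digraph has an asymmetric spanning subdigraph with the same underlying graph. -/
theorem exists_orientation (D : V → V → Prop) : ∃ E : V → V → Prop,
    (∀ u v, E u v → D u v) ∧ (∀ u v, E u v → ¬ E v u) ∧
      ∀ u v, u ≠ v → D u v → E u v ∨ E v u := by
  let _ : LinearOrder V := WellOrderingRel.isWellOrder.linearOrder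
  refine ⟨fun u v => D u v ∧ u ≠ v ∧ (D v u → u < v), fun u v h => h.1, ?_, ?_⟩
  · rintro u v ⟨h1, _, h2⟩ ⟨h3, _, h4⟩
    exact lt_asymm (h2 h3) (h4 h1)
  · intro u v hne h
    by_cases h' : D v u
    · rcases lt_or_gt_of_ne hne with h1 | h1
      · exact Or.inl ⟨h, hne, fun _ => h1⟩
      · exact Or.inr ⟨h', hne.symm, fun _ => h1⟩
    · exact Or.inl ⟨h, hne, fun h2 => absurd h2 h'⟩

theorem chromaticNumber_le_of_col [Fintype V] {D E : V → V → Prop}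
    (hE : ∀ u v, u ≠ v → D u v → E u v ∨ E v u) {m : ℕ} (h : Col E Finset.univ m) :
    (SimpleGraph.fromRel D).chromaticNumber ≤ (m : ℕ∞) := by
  obtain ⟨c, h1, h2⟩ := h
  refine SimpleGraph.Colorable.chromaticNumber_le ⟨SimpleGraph.Coloring.mk
    (fun v => (⟨c v, h1 v (Finset.mem_univ v)⟩ : Fin m)) ?_⟩
  intro u v huv he
  have hc : c u = c v := congrArg Fin.val he
  obtain ⟨hne, h3⟩ := (SimpleGraph.fromRel_adj D u v).mp huv
  have h4 : E u v ∨ E v u := by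
    rcases h3 with h3 | h3
    · exact hE u v hne h3
    · exact (hE v u hne.symm h3).symm
  rcases h4 with h4 | h4
  · exact h2 u (Finset.mem_univ u) v (Finset.mem_univ v) h4 hc
  · exact h2 v (Finset.mem_univ v) u (Finset.mem_univ u) h4 hc.symm

/-- The best of the available colour bounds for digraphs without `P(k,l,r)`. -/
theorem col_of_not_hasP3 [Fintype V] {D : V → V → Prop} (hasym : ∀ u v, D u v → ¬ D v u)
    {k l r : ℕ} (hk : 1 ≤ k) (hl : 1 ≤ l) (hr : 1 ≤ r) (h : ¬ HasP3 D k l r) {m : ℕ}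
    (hm : min (2 * (k + l + r) + 1) (4 * (k + l + r) - 9) ≤ m) : Col D Finset.univ m := by
  have hirr : ∀ v, ¬ D v v := fun v hv => hasym v v hv hv
  by_cases h5 : 5 ≤ k + l + r
  · exact (col_general hirr hk hl hr h).mono (by omega)
  have hcases : (k = 1 ∧ l = 1 ∧ r = 1) ∨ (k = 2 ∧ l = 1 ∧ r = 1) ∨ (k = 1 ∧ l = 2 ∧ r = 1) ∨
      (k = 1 ∧ l = 1 ∧ r = 2) := by omega
  rcases hcases with ⟨rfl, rfl, rfl⟩ | ⟨rfl, rfl, rfl⟩ | ⟨rfl, rfl, rfl⟩ | ⟨rfl, rfl, rfl⟩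
  · exact (col_one_one_one hasym h).mono (by omega)
  · exact (col_two_one_one hasym h).mono (by omega)
  · exact (col_one_two_one hirr h).mono (by omega)
  · refine (col_two_one_one (D := flip D) (fun u v h1 h2 => hasym _ _ h1 h2) ?_).of_flip.mono
      (by omega)
    exact fun h' => h h'.of_flip

end ThreeBlocks

/-- Combined bound: a digraph containing no three-block path `P(k,l,r)` with
`k+l+r = n-1`, `k,l,r ≥ 1` has chromatic number at most `4n - 13`, and at most
`3n - 6` when `l ≤ r`. -/
theorem three_blocks_combined {V : Type*} [Fintype V] (D : V → V → Prop) (n k l r : ℕ)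
    (hk : 1 ≤ k) (hl : 1 ≤ l) (hr : 1 ≤ r)
    (hsum : k + l + r = n - 1)
    (hfree : ¬ ContainsP3 D k l r) :
    (SimpleGraph.fromRel D).chromaticNumber ≤ ((4 * n - 13 : ℕ) : ℕ∞) ∧
    (l ≤ r → (SimpleGraph.fromRel D).chromaticNumber ≤ ((3 * n - 6 : ℕ) : ℕ∞)) := by
  have hn : ¬ ThreeBlocks.HasP3 D k l r := by
    rintro ⟨x, hx, h1, h2, h3⟩
    refine hfree ⟨fun i => x i, fun i j hij => Fin.ext (hx _ (by omega) _ (by omega) hij),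
      fun i hi => h1 i hi, fun i hi => h2 i hi.1 hi.2, fun i hi => h3 i hi.1 hi.2⟩
  obtain ⟨E, hED, hasym, hE⟩ := ThreeBlocks.exists_orientation D
  have hnE : ¬ ThreeBlocks.HasP3 E k l r := by
    rintro ⟨x, hx, h1, h2, h3⟩
    exact hn ⟨x, hx, fun i hi => hED _ _ (h1 i hi), fun i hi hi' => hED _ _ (h2 i hi hi'),
      fun i hi hi' => hED _ _ (h3 i hi hi')⟩
  refine ⟨ThreeBlocks.chromaticNumber_le_of_col hE
    (ThreeBlocks.col_of_not_hasP3 hasym hk hl hr hnE (by omega)), fun _ =>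
    ThreeBlocks.chromaticNumber_le_of_col hE
      (ThreeBlocks.col_of_not_hasP3 hasym hk hl hr hnE (by omega))⟩
end

section
/- Every digraph with chromatic number at least n contains every oriented path of length n−1 with two blocks, for n ≥ 4. -/
/-- `ContainsP2 D k₁ k₂` : the digraph `D` contains the oriented path
`P(k₁,k₂)` consisting of `k₁` forward arcs followed by `k₂` backward arcs. -/
def ContainsP2 {V : Type*} (D : V → V → Prop) (k₁ k₂ : ℕ) : Prop :=
  ∃ x : Fin (k₁ + k₂ + 1) → V, Function.Injective x ∧
    (∀ i : ℕ, ∀ _ : i < k₁, D (x ⟨i, by omega⟩) (x ⟨i + 1, by omega⟩)) ∧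
    (∀ i : ℕ, ∀ _ : k₁ ≤ i ∧ i < k₁ + k₂, D (x ⟨i + 1, by omega⟩) (x ⟨i, by omega⟩))

namespace TwoBlocks

variable {V : Type*}

/-- `p` lists, nearest vertex first, the vertices of a directed path ending at `w`. -/
def BackPath (A : V → V → Prop) (w : V) (p : List V) : Prop :=
  List.IsChain (fun a b => A b a) (w :: p) ∧ (w :: p).Nodup

/-- Two directed paths of lengths at least `k` and `l` that share only their terminal vertex. -/
def HasP (A : V → V → Prop) (k l : ℕ) : Prop :=
  ∃ w p q, BackPath A w p ∧ BackPath A w q ∧ p.Disjoint q ∧ k ≤ p.length ∧ l ≤ q.length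

theorem BackPath.cons {A : V → V → Prop} {u w : V} {q : List V} (h : BackPath A u q)
    (ha : A u w) (hne : w ≠ u) (hw : w ∉ q) : BackPath A w (u :: q) := by
  refine ⟨?_, ?_⟩
  · exact List.isChain_cons_cons.2 ⟨ha, h.1⟩
  · have := h.2
    simp_all

theorem BackPath.notMem {A : V → V → Prop} {w : V} {q : List V} (h : BackPath A w q) :
    w ∉ q := (List.nodup_cons.1 h.2).1

theorem BackPath.mono {A B : V → V → Prop} (hAB : ∀ u v, A u v → B u v) {w : V} {q : List V}
    (h : BackPath A w q) : BackPath B w q :=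
  ⟨h.1.imp fun _ _ => hAB _ _, h.2⟩

theorem backPath_of_fun {A : V → V → Prop} {n : ℕ} {g : ℕ → V}
    (ha : ∀ t, t < n → A (g (t + 1)) (g t))
    (hi : ∀ s t, s ≤ n → t ≤ n → g s = g t → s = t) :
    BackPath A (g 0) ((List.range n).map fun t => g (t + 1)) := by
  have e : g 0 :: (List.range n).map (fun t => g (t + 1)) = (List.range (n + 1)).map g := by
    rw [List.range_succ_eq_map]; simp
  rw [BackPath, e]
  refine ⟨?_, ?_⟩
  · rw [List.isChain_iff_getElem]
    intro i hi'
    simp at hi' ⊢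
    exact ha i hi'
  · refine List.Nodup.map_on ?_ List.nodup_range
    intro x hx y hy h
    simp at hx hy
    exact hi x y (by omega) (by omega) h

theorem HasP.mono {A B : V → V → Prop} (hAB : ∀ u v, A u v → B u v) {k l : ℕ}
    (h : HasP A k l) : HasP B k l := by
  obtain ⟨w, p, q, hp, hq, h⟩ := h
  exact ⟨w, p, q, hp.mono hAB, hq.mono hAB, h⟩

theorem HasP.symm {A : V → V → Prop} {k l : ℕ} (h : HasP A k l) : HasP A l k := by
  obtain ⟨w, p, q, hp, hq, hd, h1, h2⟩ := h
  exact ⟨w, q, p, hq, hp, hd.symm, h2, h1⟩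

theorem mod_ne_mod {k i j : ℕ} (h1 : i < j) (h2 : j ≤ i + k) : i % (k + 1) ≠ j % (k + 1) := by
  intro h
  have := Nat.le_of_dvd (by omega) ((Nat.modEq_iff_dvd' h1.le).1 h)
  omega

/-- Colouring the vertices `0, …, p - 1` of a circuit with `k + 1` colours. -/
theorem circuit_coloring (B : ℕ → ℕ → Prop) (k p : ℕ) (hk2 : 2 ≤ k) (hp : k + 1 ≤ p)
    (hstep : ∀ i, i + 1 < p → B i (i + 1))
    (hroot : ∀ i j, i < j → j < p → B i j → ∀ g : ℕ → ℕ, g 0 = j →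
      (∀ t, t ≤ k → i < g t ∧ g t < p) → (∀ s t, s ≤ k → t ≤ k → g s = g t → s = t) →
      (∀ t, t < k → B (g (t + 1)) (g t)) → False)
    (hzero : ∀ i, k ≤ i → i < p → B i 0 → i = p - 1)
    (hchord : ∀ i j, i + 2 ≤ j → j < p → B i j → p + i + 1 ≤ k + j) :
    ∃ f : ℕ → ℕ, (∀ i, f i < k + 1) ∧
      ∀ i j, i < p → j < p → i ≠ j → B i j → f i ≠ f j := by
  have hfwd : ∀ i j, i < j → j < p → B i j → j ≤ i + k := by
    intro i j hij hj hB
    by_contra hc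
    refine hroot i j hij hj hB (fun t => j - t) (by simp) (fun t ht => by omega)
      (fun s t hs ht h => by omega) (fun t ht => ?_)
    have := hstep (j - (t + 1)) (by omega)
    have e : j - (t + 1) + 1 = j - t := by omega
    rwa [e] at this
  have hbwd : ∀ i j, 1 ≤ j → j < i → i < p → B i j → i < j + k := by
    intro i j h1 hij hi hB
    by_contra hc
    have hB' := hstep (j - 1) (by omega)
    have e : j - 1 + 1 = j := by omega
    rw [e] at hB'
    refine hroot (j - 1) j (by omega) (by omega) hB' (fun t => if t = 0 then j else i + 1 - t)
      (by simp) (fun t ht => by split_ifs <;> omega)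
      (fun s t hs ht h => by split_ifs at h <;> omega) (fun t ht => ?_)
    by_cases h0 : t = 0
    · subst h0; simpa using hB
    · have := hstep (i + 1 - (t + 1)) (by omega)
      have e : i + 1 - (t + 1) + 1 = i + 1 - t := by omega
      rw [e] at this
      simpa [h0] using this
  have hk1 : 0 < k + 1 := by omega
  by_cases hsmall : p = k + 1
  · refine ⟨fun i => i % (k + 1), fun i => Nat.mod_lt _ hk1, fun i j hi hj hij _ => ?_⟩
    dsimp
    rw [Nat.mod_eq_of_lt (by omega), Nat.mod_eq_of_lt (by omega)]
    exact hij
  -- a colour that the root can take, given that the remaining vertices are coloured modulo `k + 1`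
  have key : ∀ a, a < k + 1 → (∀ i, 1 ≤ i → i < p → i % (k + 1) = a → ¬ B i 0 ∧ ¬ B 0 i) →
      ∃ f : ℕ → ℕ, (∀ i, f i < k + 1) ∧
        ∀ i j, i < p → j < p → i ≠ j → B i j → f i ≠ f j := by
    intro a ha hfree
    refine ⟨fun i => if i = 0 then a else i % (k + 1), fun i => ?_, ?_⟩
    · dsimp; split_ifs
      exacts [ha, Nat.mod_lt _ hk1]
    intro i j hi hj hij hB
    dsimp
    split_ifs with h1 h2 h2
    · omega
    · subst h1
      exact fun h => (hfree j (by omega) hj h.symm).2 hB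
    · subst h2
      exact fun h => (hfree i (by omega) hi h).1 hB
    · rcases lt_or_gt_of_ne hij with h | h
      · exact mod_ne_mod h (hfwd i j h hj hB)
      · exact (mod_ne_mod h (by have := hbwd i j (by omega) h hi hB; omega)).symm
  by_cases hdiv : (p - 1) % (k + 1) = 0
  swap
  · refine key 0 hk1 fun i h1 hi hm => ⟨fun hB => ?_, fun hB => ?_⟩
    · by_cases hik : k ≤ i
      · rw [hzero i hik hi hB] at hm; exact hdiv hm
      · rw [Nat.mod_eq_of_lt (by omega)] at hm; omega
    · have := hfwd 0 i h1 hi hB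
      rw [Nat.mod_eq_of_lt (by omega)] at hm; omega
  by_cases h0k : B 0 k
  swap
  · refine key k (by omega) fun i h1 hi hm => ⟨fun hB => ?_, fun hB => ?_⟩
    · by_cases hik : k ≤ i
      · rw [hzero i hik hi hB] at hm; omega
      · rw [Nat.mod_eq_of_lt (by omega)] at hm; omega
    · have := hfwd 0 i h1 hi hB
      rw [Nat.mod_eq_of_lt (by omega)] at hm
      subst hm; exact h0k hB
  have hp2 := hchord 0 k (by omega) (by omega) h0k
  have hpk : p = k + 2 := by
    obtain ⟨m, hm⟩ := Nat.dvd_of_mod_eq_zero hdiv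
    have : m = 1 := by
      rcases m with _ | _ | m
      · omega
      · rfl
      · exfalso; nlinarith [Nat.sub_add_cancel (show 1 ≤ p by omega)]
    subst this; omega
  subst hpk
  by_cases hadj : ∃ i, 1 ≤ i ∧ i ≤ k - 1 ∧ ¬ B i (k + 1) ∧ ¬ B (k + 1) i
  · obtain ⟨a, ha1, ha2, hn1, hn2⟩ := hadj
    refine ⟨fun i => if i ≤ k then i else a, fun i => ?_, ?_⟩
    · dsimp; split_ifs <;> omega
    intro i j hi hj hij hB
    dsimp
    split_ifs with h1 h2 h2
    · exact hij
    · rintro rfl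
      exact hn1 (by rwa [show j = k + 1 by omega] at hB)
    · rintro rfl
      exact hn2 (by rwa [show i = k + 1 by omega] at hB)
    · omega
  exfalso
  push Not at hadj
  have h1 : B 1 (k + 1) := by
    by_contra h
    have := hbwd (k + 1) 1 le_rfl (by omega) (by omega) (hadj 1 le_rfl (by omega) h)
    omega
  have hlast : ¬ B (k - 1) (k + 1) := by
    intro h
    have := hchord (k - 1) (k + 1) (by omega) (by omega) h
    omega
  obtain ⟨i, hi1, hi2, hBi, hBi'⟩ : ∃ i, 1 ≤ i ∧ i + 1 ≤ k - 1 ∧ B i (k + 1) ∧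
      ¬ B (i + 1) (k + 1) := by
    by_contra hc
    push Not at hc
    have : ∀ i, 1 ≤ i → i ≤ k - 1 → B i (k + 1) := by
      intro i hi
      induction i, hi using Nat.le_induction with
      | base => exact fun _ => h1
      | succ i hi ih => exact fun h => hc i hi h (ih (by omega))
    exact hlast (this (k - 1) (by omega) le_rfl)
  have hback := hadj (i + 1) (by omega) hi2 hBi'
  refine hroot 0 k (by omega) (by omega) h0k
    (fun t => if t + i < k then k - t else if t + i = k then k + 1 else k + 1 - t)
    (by simp; omega) (fun t ht => by split_ifs <;> omega)
    (fun s t hs ht h => by split_ifs at h <;> omega) (fun t ht => ?_)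
  rcases lt_trichotomy (t + 1 + i) k with h | h | h
  · rw [if_pos h, if_pos (by omega)]
    have := hstep (k - (t + 1)) (by omega)
    rwa [show k - (t + 1) + 1 = k - t by omega] at this
  · rw [if_neg (by omega), if_pos h, if_pos (by omega)]
    rwa [show k - t = i + 1 by omega]
  · rw [if_neg (by omega), if_neg (by omega), if_neg (by omega)]
    split_ifs with h'
    · rwa [show k + 1 - (t + 1) = i by omega]
    · have := hstep (k + 1 - (t + 1)) (by omega)
      rwa [show k + 1 - (t + 1) + 1 = k + 1 - t by omega] at this

/-- A rooted spanning forest whose edges are arcs of `A`, given by the list of ancestors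
`pth v = [v, …, root]` of every vertex; the level of `v` is the length of `pth v`. -/
def IsForest (A : V → V → Prop) (pth : V → List V) : Prop :=
  ∀ v, pth v = [v] ∨ ∃ u, A u v ∧ pth v = v :: pth u

/-- A forest for which every arc ascends to a higher level or ends at an ancestor of its tail. -/
def IsFinal (A : V → V → Prop) (pth : V → List V) : Prop :=
  ∀ u v, A u v → (pth u).length < (pth v).length ∨ v ∈ pth u

namespace IsForest

variable {A : V → V → Prop} {pth : V → List V}

theorem induct (h : IsForest A pth) {P : V → Prop} (h1 : ∀ v, pth v = [v] → P v)
    (h2 : ∀ u v, A u v → pth v = v :: pth u → P u → P v) (v : V) : P v := by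
  induction hn : (pth v).length using Nat.strong_induction_on generalizing v with
  | _ n ih =>
    rcases h v with hv | ⟨u, hu, hv⟩
    · exact h1 v hv
    · exact h2 u v hu hv (ih _ (by rw [← hn, hv]; simp) u rfl)

theorem head_eq (h : IsForest A pth) (v : V) : pth v = v :: (pth v).tail := by
  rcases h v with hv | ⟨u, _, hv⟩ <;> rw [hv] <;> rfl

theorem self_mem (h : IsForest A pth) (v : V) : v ∈ pth v := by
  rw [h.head_eq v]; simp

theorem length_pos (h : IsForest A pth) (v : V) : 0 < (pth v).length :=
  List.length_pos_of_mem (h.self_mem v)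

theorem suffix_of_mem (h : IsForest A pth) {w v : V} : w ∈ pth v → pth w <:+ pth v := by
  induction v using h.induct with
  | h1 v hv => intro hw; rw [hv] at hw; simp at hw; rw [hw]
  | h2 u v _ hv ih =>
    intro hw
    rw [hv] at hw
    rcases List.mem_cons.1 hw with rfl | hw
    · exact List.suffix_rfl
    · rw [hv]; exact (ih hw).trans (List.suffix_cons _ _)

theorem length_le (h : IsForest A pth) {w v : V} (hw : w ∈ pth v) :
    (pth w).length ≤ (pth v).length := (h.suffix_of_mem hw).length_le

theorem mem_trans (h : IsForest A pth) {x w v : V} (hx : x ∈ pth w) (hw : w ∈ pth v) :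
    x ∈ pth v := (h.suffix_of_mem hw).subset hx

theorem eq_of_length_eq (h : IsForest A pth) {w x v : V} (hw : w ∈ pth v) (hx : x ∈ pth v)
    (he : (pth w).length = (pth x).length) : w = x := by
  have := (List.suffix_of_suffix_length_le (h.suffix_of_mem hw) (h.suffix_of_mem hx)
    he.le).eq_of_length he
  rw [h.head_eq w, h.head_eq x] at this
  exact (List.cons.inj this).1

theorem backPath (h : IsForest A pth) (v : V) : BackPath A v (pth v).tail := by
  rw [BackPath, ← h.head_eq]
  induction v using h.induct with
  | h1 v hv => rw [hv]; simp
  | h2 u v hu hv ih =>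
    refine ⟨?_, ?_⟩
    · rw [hv, h.head_eq u]
      refine List.isChain_cons_cons.2 ⟨hu, ?_⟩
      rw [← h.head_eq u]; exact ih.1
    · rw [hv]
      refine List.nodup_cons.2 ⟨fun hm => ?_, ih.2⟩
      have := h.length_le hm
      rw [hv] at this; simp at this

theorem nodup (h : IsForest A pth) (v : V) : (pth v).Nodup := by
  have := (h.backPath v).2
  rwa [← h.head_eq v] at this

theorem length_lt_of_mem_tail (h : IsForest A pth) {w v : V} (hw : w ∈ (pth v).tail) :
    (pth w).length < (pth v).length := by
  refine lt_of_le_of_ne (h.length_le (List.mem_of_mem_tail hw)) fun he => ?_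
  have := h.eq_of_length_eq (List.mem_of_mem_tail hw) (h.self_mem v) he
  exact (h.backPath v).notMem (this ▸ hw)

theorem exists_level (h : IsForest A pth) (v : V) {m : ℕ} (h1 : 1 ≤ m) :
    m ≤ (pth v).length → ∃ r ∈ pth v, (pth r).length = m := by
  induction v using h.induct with
  | h1 v hv => exact fun hm => ⟨v, h.self_mem v, by rw [hv] at hm ⊢; simp at hm ⊢; omega⟩
  | h2 u v _ hv ih =>
    intro hm
    by_cases hmu : m ≤ (pth u).length
    · obtain ⟨r, hr, hl⟩ := ih hmu
      exact ⟨r, by rw [hv]; exact List.mem_cons_of_mem _ hr, hl⟩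
    · exact ⟨v, h.self_mem v, by rw [hv] at hm ⊢; simp at hm ⊢; omega⟩

/-- A directed path ending at an ancestor `r` of `u` extends along the forest to one ending
at `u`. -/
theorem climb (h : IsForest A pth) {B : V → V → Prop} (hAB : ∀ u v, A u v → B u v)
    {r : V} {p : List V} (hp : BackPath B r p) {u : V} :
    r ∈ pth u → (∀ x ∈ p, x ∈ pth u → (pth x).length < (pth r).length) →
    ∃ t, BackPath B u t ∧ t.length + (pth r).length = p.length + (pth u).length ∧
      ∀ x ∈ t, x ∈ p ∨ (x ∈ pth u ∧ (pth r).length ≤ (pth x).length) := by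
  induction u using h.induct with
  | h1 v hv =>
    intro hr _
    rw [hv] at hr; simp at hr; subst hr
    exact ⟨p, hp, rfl, fun x hx => Or.inl hx⟩
  | h2 u v hu hv ih =>
    intro hr hd
    by_cases hrv : r = v
    · subst hrv; exact ⟨p, hp, rfl, fun x hx => Or.inl hx⟩
    have hru : r ∈ pth u := by
      rw [hv] at hr; exact (List.mem_cons.1 hr).resolve_left hrv
    obtain ⟨t, ht, hl, hx⟩ := ih hru fun x hx hxu =>
      hd x hx (by rw [hv]; exact List.mem_cons_of_mem _ hxu)
    have hvu : v ∉ pth u := by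
      have := h.nodup v; rw [hv] at this; exact (List.nodup_cons.1 this).1
    refine ⟨u :: t, ht.cons (hAB _ _ hu) ?_ ?_, ?_, ?_⟩
    · rintro rfl; exact hvu (h.self_mem v)
    · intro hm
      rcases hx v hm with h' | h'
      · have := hd v h' (h.self_mem v)
        have := h.length_le hr
        omega
      · exact hvu h'.1
    · rw [hv]; simp; omega
    · intro x hm
      rw [hv]
      rcases List.mem_cons.1 hm with rfl | hm
      · exact Or.inr ⟨List.mem_cons_of_mem _ (h.self_mem x), h.length_le hru⟩
      · rcases hx x hm with h' | h'
        · exact Or.inl h'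
        · exact Or.inr ⟨List.mem_cons_of_mem _ h'.1, h'.2⟩

theorem length_takeWhile [DecidableEq V] (h : IsForest A pth) {v w : V} : v ∈ pth w →
    ((pth w).takeWhile (fun x => decide (x ≠ v))).length + (pth v).length = (pth w).length := by
  induction w using h.induct with
  | h1 w hw => intro hv; rw [hw] at hv; simp at hv; subst hv; rw [hw]; simp
  | h2 u w _ hw ih =>
    intro hv
    by_cases hvw : w = v
    · subst hvw; nth_rw 1 [hw]; simp
    · have : v ∈ pth u := by
        rw [hw] at hv; exact (List.mem_cons.1 hv).resolve_left (Ne.symm hvw)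
      have := ih this
      rw [hw, List.takeWhile_cons_of_pos (by simpa using hvw)]
      simp only [List.length_cons]; omega

/-- Hanging the subtree of `v` below another vertex `u`. -/
theorem reattach [DecidableEq V] (h : IsForest A pth) {u v : V} (huv : A u v) (hv : v ∉ pth u) :
    IsForest A fun w => if v ∈ pth w then
      (pth w).takeWhile (fun x => decide (x ≠ v)) ++ v :: pth u else pth w := by
  intro w
  by_cases hvw : v ∈ pth w
  · simp only [hvw, if_true]
    by_cases hw : w = v
    · subst hw
      refine Or.inr ⟨u, huv, ?_⟩
      rw [if_neg hv, h.head_eq w]; simp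
    · rcases h w with h' | ⟨x, hx, h'⟩
      · rw [h'] at hvw; simp at hvw; exact absurd hvw.symm hw
      · have hvx : v ∈ pth x := by
          rw [h'] at hvw; exact (List.mem_cons.1 hvw).resolve_left (Ne.symm hw)
        refine Or.inr ⟨x, hx, ?_⟩
        rw [if_pos hvx, h', List.takeWhile_cons_of_pos (by simpa using hw)]; rfl
  · simp only [hvw, if_false]
    rcases h w with h' | ⟨x, hx, h'⟩
    · exact Or.inl h'
    · refine Or.inr ⟨x, hx, ?_⟩
      rw [if_neg, h']
      intro hm; apply hvw; rw [h']; exact List.mem_cons_of_mem _ hm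

theorem exists_isFinal [Fintype V] (h : IsForest A pth) :
    ∃ pth', IsForest A pth' ∧ IsFinal A pth' ∧ ∀ v, (pth v).length ≤ (pth' v).length := by
  classical
  induction hn : Fintype.card V * Fintype.card V - ∑ v, (pth v).length
    using Nat.strong_induction_on generalizing pth with
  | _ n ih =>
    by_cases hf : IsFinal A pth
    · exact ⟨pth, h, hf, fun _ => le_rfl⟩
    unfold IsFinal at hf
    push Not at hf
    obtain ⟨u, v, huv, hlev, hv⟩ := hf
    have h' := h.reattach huv hv
    set pth₂ : V → List V := fun w => if v ∈ pth w then
      (pth w).takeWhile (fun x => decide (x ≠ v)) ++ v :: pth u else pth w with hdef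
    have hle : ∀ w, (pth w).length ≤ (pth₂ w).length := by
      intro w
      simp only [hdef]
      split_ifs with hw
      · have := h.length_takeWhile hw
        simp only [List.length_append, List.length_cons]; omega
      · exact le_rfl
    have hlt : (pth v).length < (pth₂ v).length := by
      have := h.length_takeWhile (h.self_mem v)
      simp only [hdef, h.self_mem v, if_true]
      simp only [List.length_append, List.length_cons]; omega
    have hsum : ∑ w, (pth w).length < ∑ w, (pth₂ w).length :=
      Finset.sum_lt_sum (fun w _ => hle w) ⟨v, Finset.mem_univ v, hlt⟩
    have hbound : ∑ w, (pth₂ w).length ≤ Fintype.card V * Fintype.card V := by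
      have := Finset.sum_le_card_nsmul Finset.univ (fun w => (pth₂ w).length) (Fintype.card V)
        fun w _ => (h'.nodup w).length_le_card
      simpa using this
    obtain ⟨pth₃, h1, h2, h3⟩ := ih _ (by omega) h' rfl
    exact ⟨pth₃, h1, h2, fun w => (hle w).trans (h3 w)⟩

end IsForest

/-- The arcs of `A` with both ends outside `W`. -/
def Avoid (A : V → V → Prop) (W : Set V) (u v : V) : Prop := A u v ∧ u ∉ W ∧ v ∉ W

theorem IsForest.notMem_of_mem {A : V → V → Prop} {W : Set V} {pth : V → List V}
    (h : IsForest (Avoid A W) pth) {x v : V} : v ∉ W → x ∈ pth v → x ∉ W := by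
  induction v using h.induct with
  | h1 v hv => intro hW hx; rw [hv] at hx; simp at hx; rwa [hx]
  | h2 u v hu hv ih =>
    intro hW hx
    rw [hv] at hx
    rcases List.mem_cons.1 hx with rfl | hx
    · exact hW
    · exact ih hu.2.1 hx

/-- Deleting a set `C` from a forest: paths are cut at the first vertex of `C`, and the levels of
vertices without ancestors in `C` do not change. -/
theorem IsForest.exists_delete {A : V → V → Prop} {W C : Set V} {pth : V → List V}
    (h : IsForest (Avoid A W) pth) :
    ∃ pth', IsForest (Avoid A (W ∪ C)) pth' ∧
      ∀ v, (∀ x ∈ pth v, x ∉ C) → pth' v = pth v := by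
  classical
  refine ⟨fun v => if v ∈ C then [v] else (pth v).takeWhile fun x => decide (x ∉ C), ?_, ?_⟩
  · intro v
    by_cases hv : v ∈ C
    · simp [hv]
    simp only [hv, if_false]
    rcases h v with h' | ⟨u, hu, h'⟩
    · left; rw [h']; simp [hv]
    rw [h', List.takeWhile_cons_of_pos (by simpa using hv)]
    by_cases huC : u ∈ C
    · left; rw [h.head_eq u, List.takeWhile_cons_of_neg (by simpa using huC)]
    · right
      refine ⟨u, ⟨hu.1, ?_, ?_⟩, by simp [huC]⟩
      · simp [hu.2.1, huC]
      · simp [hu.2.2, hv]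
  · intro v hv
    simp only [if_neg (hv v (h.self_mem v))]
    exact List.takeWhile_eq_self_iff.2 fun x hx => by simpa using hv x hx

theorem BackPath.append {A : V → V → Prop} {r e z : V} {q s : List V}
    (h : BackPath A r (q ++ [e])) (hz : A z e) (hs : BackPath A z s)
    (hd : ∀ x ∈ z :: s, x ≠ r ∧ x ∉ q ++ [e]) : BackPath A r ((q ++ [e]) ++ z :: s) := by
  rw [BackPath, ← List.cons_append]
  refine ⟨List.isChain_append.2 ⟨h.1, hs.1, ?_⟩, List.nodup_append.2 ⟨h.2, hs.2, ?_⟩⟩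
  · intro x hx y hy
    rw [← List.cons_append, List.getLast?_concat] at hx
    simp at hx hy
    subst hx hy; exact hz
  · rintro a ha b hb rfl
    rcases List.mem_cons.1 ha with h' | h'
    · exact (hd a hb).1 h'
    · exact (hd a hb).2 h'

theorem IsForest.backPath_cons {A B : V → V → Prop} {pth : V → List V} (h : IsForest A pth)
    (hAB : ∀ u v, A u v → B u v) {u w : V} (huw : B u w) (hw : w ∉ pth u) :
    BackPath B w (pth u) := by
  rw [h.head_eq u] at hw ⊢
  simp only [List.mem_cons, not_or] at hw
  exact ((h.backPath u).mono hAB).cons huw hw.1 hw.2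

/-- A partial colouring of `A`: the set `W` is coloured by `f` with `k + 1` colours, every vertex
of `W` ends a long directed path inside `W`, and the remaining vertices carry a final forest. -/
structure PartialColoring (A : V → V → Prop) (k l : ℕ) (W : Set V) (f : V → ℕ)
    (pth : V → List V) : Prop where
  forest : IsForest (Avoid A W) pth
  final : IsFinal (Avoid A W) pth
  long : ∀ c ∈ W, ∃ p, BackPath A c p ∧ (∀ x ∈ p, x ∈ W) ∧ k ≤ p.length
  lt : ∀ c, f c < k + 1
  proper : ∀ c ∈ W, ∀ d ∈ W, A c d → f c ≠ f d
  entry : ∀ r ∉ W, (∀ γ < k + 1, ∃ c ∈ W, A c r ∧ f c = γ) →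
    ∃ p q e, BackPath A r p ∧ BackPath A r (q ++ [e]) ∧ p.Disjoint (q ++ [e]) ∧
      (∀ x ∈ p, x ∈ W) ∧ (∀ x ∈ q ++ [e], x ∈ W) ∧ k ≤ p.length ∧
      (l = 1 ∨ ∃ z ∉ W, l ≤ (pth z).length + 1 ∧ A z e)

theorem avoid_le {A : V → V → Prop} {W : Set V} (u v : V) (h : Avoid A W u v) : A u v := h.1

namespace PartialColoring

variable {A : V → V → Prop} {k l : ℕ} {W : Set V} {f : V → ℕ} {pth : V → List V}

theorem level_lt_of_arc_to (S : PartialColoring A k l W f pth) (hP : ¬ HasP A k l) {z c : V}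
    (hz : z ∉ W) (hc : c ∈ W) (h : A z c) : (pth z).length < l := by
  by_contra hl
  obtain ⟨p, hp, hpW, hpk⟩ := S.long c hc
  have hout : ∀ x ∈ pth z, x ∉ W := fun x hx => S.forest.notMem_of_mem hz hx
  exact hP ⟨c, p, pth z, hp, S.forest.backPath_cons avoid_le h fun hm => hout c hm hc,
    fun x hx hx' => hout x hx' (hpW x hx), hpk, by omega⟩

theorem level_le_of_arc_from (S : PartialColoring A k l W f pth) (hA : ∀ u v, A u v → u ≠ v)
    (hP : ¬ HasP A k l) {c u : V} (hc : c ∈ W) (hu : u ∉ W) (h : A c u) :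
    (pth u).length ≤ l := by
  by_contra hl
  obtain ⟨p, hp, hpW, hpk⟩ := S.long c hc
  refine hP ⟨u, c :: p, (pth u).tail, hp.cons h (hA _ _ h).symm fun hm => hu (hpW u hm),
    (S.forest.backPath u).mono avoid_le, fun x hx hx' => ?_, by simp; omega, by simp; omega⟩
  refine S.forest.notMem_of_mem hu (List.mem_of_mem_tail hx') ?_
  rcases List.mem_cons.1 hx with rfl | hx
  exacts [hc, hpW x hx]

theorem exists_missing (S : PartialColoring A k l W f pth) (hl : 1 ≤ l)
    (hP : ¬ HasP A k l) {r : V} (hr : r ∉ W) (hrl : l ≤ (pth r).length) :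
    ∃ γ < k + 1, ∀ c ∈ W, A c r → f c ≠ γ := by
  by_contra hc
  push Not at hc
  obtain ⟨p, q, e, hp, hq, hd, hpW, hqW, hpk, hz⟩ := S.entry r hr hc
  rcases hz with rfl | ⟨z, hzW, hzl, hze⟩
  · exact hP ⟨r, p, q ++ [e], hp, hq, hd, hpk, by simp⟩
  have hzlt := S.level_lt_of_arc_to hP hzW (hqW e (by simp)) hze
  have hout : ∀ x ∈ pth z, x ∉ W := fun x hx => S.forest.notMem_of_mem hzW hx
  refine hP ⟨r, p, (q ++ [e]) ++ z :: (pth z).tail, hp,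
    hq.append hze ((S.forest.backPath z).mono avoid_le) ?_, ?_, hpk, ?_⟩
  · intro x hx
    rw [← S.forest.head_eq] at hx
    refine ⟨?_, fun h => hout x hx (hqW x h)⟩
    rintro rfl
    have := S.forest.length_le hx
    omega
  · intro x hx hx'
    rw [← S.forest.head_eq] at hx'
    rcases List.mem_append.1 hx' with h | h
    · exact hd hx h
    · exact hout x h (hpW x hx)
  · rw [← S.forest.head_eq]; simp; omega

theorem level_le_add (S : PartialColoring A k l W f pth) (hP : ¬ HasP A k l) {u v : V}
    (h : A u v) (hul : l ≤ (pth u).length) (huv : (pth u).length < (pth v).length) :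
    (pth v).length ≤ (pth u).length + k := by
  by_contra hlt
  obtain ⟨r, hr, hrl⟩ := S.forest.exists_level v (m := (pth u).length + 1) (by omega) (by omega)
  obtain ⟨t, ht, htl, htx⟩ := S.forest.climb (B := A) avoid_le (r := r) (p := [])
    ⟨by simp, by simp⟩ hr (by simp)
  refine hP ⟨v, t, pth u, ht, S.forest.backPath_cons avoid_le h fun hm => ?_, fun x hx hx' => ?_,
    by simp at htl; omega, hul⟩
  · have := S.forest.length_le hm; omega
  · have := S.forest.length_le hx'
    rcases htx x hx with h' | h'
    · simp at h'
    · omega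

theorem level_lt_add (S : PartialColoring A k l W f pth) (hA : ∀ u v, A u v → u ≠ v)
    (hP : ¬ HasP A k l) {u v : V}
    (h : A u v) (hvl : l < (pth v).length) (hv : v ∈ pth u) :
    (pth u).length < (pth v).length + k := by
  by_contra hlt
  have hne := hA _ _ h
  have hvu : (pth v).length < (pth u).length :=
    lt_of_le_of_ne (S.forest.length_le hv) fun he =>
      hne (S.forest.eq_of_length_eq hv (S.forest.self_mem u) he).symm
  obtain ⟨r, hr, hrl⟩ := S.forest.exists_level u (m := (pth v).length + 1) (by omega) (by omega)
  obtain ⟨t, ht, htl, htx⟩ := S.forest.climb (B := A) avoid_le (r := r) (p := [])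
    ⟨by simp, by simp⟩ hr (by simp)
  have hlev : ∀ x ∈ u :: t, (pth v).length < (pth x).length := by
    intro x hx
    rcases List.mem_cons.1 hx with rfl | hx
    · exact hvu
    rcases htx x hx with h' | h'
    · simp at h'
    · omega
  refine hP ⟨v, u :: t, (pth v).tail, ht.cons h hne.symm fun hm => ?_,
    (S.forest.backPath v).mono avoid_le, fun x hx hx' => ?_,
    by simp at htl ⊢; omega, by simp; omega⟩
  · exact absurd (hlev v (List.mem_cons_of_mem _ hm)) (lt_irrefl _)
  · have := hlev x hx
    have := S.forest.length_lt_of_mem_tail hx'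
    omega

/-- An arc between vertices of level at least `l` with different ancestors at level `l` does not
interact with `W`: neither ancestor has an in-neighbour in `W`. -/
theorem eq_of_special (S : PartialColoring A k l W f pth) (hA : ∀ u v, A u v → u ≠ v)
    (hl : 1 ≤ l) (hP : ¬ HasP A k l) {u v r s : V} (hu : u ∉ W) (hv : v ∉ W) (h : A u v)
    (hr : r ∈ pth u) (hrl : (pth r).length = l) (hs : s ∈ pth v) (hsl : (pth s).length = l)
    (hW : ∃ c ∈ W, A c r ∨ A c s) : r = s := by
  by_contra hrs
  have hcommon : ∀ x, x ∈ pth u → x ∈ pth v → l ≤ (pth x).length → False := by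
    intro x hxu hxv hxl
    obtain ⟨y, hy, hyl⟩ := S.forest.exists_level x hl hxl
    apply hrs
    rw [← S.forest.eq_of_length_eq (S.forest.mem_trans hy hxu) hr (hyl.trans hrl.symm),
      ← S.forest.eq_of_length_eq (S.forest.mem_trans hy hxv) hs (hyl.trans hsl.symm)]
  have hvl : l ≤ (pth v).length := hsl ▸ S.forest.length_le hs
  have hul : l ≤ (pth u).length := hrl ▸ S.forest.length_le hr
  have hvu : v ∉ pth u := fun hm => hcommon v hm (S.forest.self_mem v) hvl
  have huv : (pth u).length < (pth v).length :=
    (S.final u v ⟨h, hu, hv⟩).resolve_right hvu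
  have houtu : ∀ x ∈ pth u, x ∉ W := fun x hx => S.forest.notMem_of_mem hu hx
  have houtv : ∀ x ∈ pth v, x ∉ W := fun x hx => S.forest.notMem_of_mem hv hx
  obtain ⟨c, hc, hcr⟩ := hW
  obtain ⟨p, hp, hpW, hpk⟩ := S.long c hc
  have hcpW : ∀ x ∈ c :: p, x ∈ W := by
    intro x hx
    rcases List.mem_cons.1 hx with rfl | hx
    exacts [hc, hpW x hx]
  rcases hcr with hcr | hcs
  · have hrp : BackPath A r (c :: p) :=
      hp.cons hcr (hA _ _ hcr).symm fun hm => houtu r hr (hpW r hm)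
    obtain ⟨t, ht, htl, htx⟩ := S.forest.climb avoid_le hrp hr
      fun x hx hx' => absurd (hcpW x hx) (houtu x hx')
    simp only [List.length_cons] at htl
    refine hP ⟨v, u :: t, (pth v).tail, ht.cons h (hA _ _ h).symm fun hm => ?_,
      (S.forest.backPath v).mono avoid_le, fun x hx hx' => ?_, by simp; omega, by simp; omega⟩
    · rcases htx v hm with h' | h'
      · exact hv (hcpW v h')
      · exact hvu h'.1
    · have hxv := List.mem_of_mem_tail hx'
      rcases List.mem_cons.1 hx with rfl | hx
      · exact hcommon x (S.forest.self_mem x) hxv hul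
      rcases htx x hx with h' | h'
      · exact houtv x hxv (hcpW x h')
      · exact hcommon x h'.1 hxv (hrl ▸ h'.2)
  · have hsp : BackPath A s (c :: p) :=
      hp.cons hcs (hA _ _ hcs).symm fun hm => houtv s hs (hpW s hm)
    obtain ⟨t, ht, htl, htx⟩ := S.forest.climb avoid_le hsp hs
      fun x hx hx' => absurd (hcpW x hx) (houtv x hx')
    simp only [List.length_cons] at htl
    refine hP ⟨v, t, pth u, ht, S.forest.backPath_cons avoid_le h hvu, fun x hx hx' => ?_,
      by omega, hul⟩
    rcases htx x hx with h' | h'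
    · exact houtu x hx' (hcpW x h')
    · exact hcommon x hx' h'.1 (hsl ▸ h'.2)

theorem swap_zero_lt {k γ x : ℕ} (hγ : γ < k + 1) (hx : x < k + 1) :
    Equiv.swap 0 γ x < k + 1 := by
  rw [Equiv.swap_apply_def]; split_ifs <;> omega

/-- A partial colouring without long backward arcs to level `l` extends to a proper colouring. -/
theorem exists_coloring (S : PartialColoring A k l W f pth) (hA : ∀ u v, A u v → u ≠ v)
    (hl : 1 ≤ l) (hP : ¬ HasP A k l)
    (hterm : ∀ x ∉ W, ∀ y ∉ W, A x y → (pth y).length = l → y ∈ pth x →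
      (pth x).length < l + k) :
    ∃ F : V → ℕ, (∀ v, F v < k + l) ∧ ∀ u v, A u v → F u ≠ F v := by
  classical
  have hanc : ∀ v, ∃ r, l ≤ (pth v).length → r ∈ pth v ∧ (pth r).length = l := by
    intro v
    by_cases hv : l ≤ (pth v).length
    · obtain ⟨r, h1, h2⟩ := S.forest.exists_level v hl hv
      exact ⟨r, fun _ => ⟨h1, h2⟩⟩
    · exact ⟨v, fun h => absurd h hv⟩
  choose anc hanc using hanc
  have hmiss : ∀ r, ∃ γ < k + 1, r ∉ W → l ≤ (pth r).length → ∀ c ∈ W, A c r → f c ≠ γ := by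
    intro r
    by_cases hr : r ∉ W ∧ l ≤ (pth r).length
    · obtain ⟨γ, h1, h2⟩ := S.exists_missing hl hP hr.1 hr.2
      exact ⟨γ, h1, fun _ _ => h2⟩
    · exact ⟨0, by omega, fun h1 h2 => absurd ⟨h1, h2⟩ hr⟩
  choose γ hγ hγm using hmiss
  let σ : V → Equiv.Perm ℕ := fun r => if ∃ c ∈ W, A c r then Equiv.swap 0 (γ r) else 1
  have hσ : ∀ r x, x < k + 1 → σ r x < k + 1 := by
    intro r x hx
    simp only [σ]
    split_ifs
    · exact swap_zero_lt (hγ r) hx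
    · exact hx
  let F : V → ℕ := fun v => if v ∈ W then f v else if (pth v).length < l then k + (pth v).length
    else σ (anc v) (((pth v).length - l) % (k + 1))
  have hFW : ∀ v ∈ W, F v = f v := fun v hv => by simp only [F, if_pos hv]
  have hFlow : ∀ v ∉ W, (pth v).length < l → F v = k + (pth v).length := fun v hv h => by
    simp only [F, if_neg hv, if_pos h]
  have hFhigh : ∀ v ∉ W, l ≤ (pth v).length →
      F v = σ (anc v) (((pth v).length - l) % (k + 1)) := fun v hv h => by
    simp only [F, if_neg hv, if_neg (not_lt.2 h)]
  have hmod : ∀ m, m % (k + 1) < k + 1 := fun m => Nat.mod_lt _ (by omega)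
  refine ⟨F, fun v => ?_, fun u v huv => ?_⟩
  · by_cases hv : v ∈ W
    · rw [hFW v hv]; have := S.lt v; omega
    rcases lt_or_ge (pth v).length l with h | h
    · rw [hFlow v hv h]; omega
    · rw [hFhigh v hv h]
      have := hσ (anc v) _ (hmod ((pth v).length - l))
      omega
  have hpos := S.forest.length_pos
  by_cases hu : u ∈ W
  · by_cases hv : v ∈ W
    · rw [hFW u hu, hFW v hv]; exact S.proper u hu v hv huv
    have hvl := S.level_le_of_arc_from hA hP hu hv huv
    rw [hFW u hu]
    rcases lt_or_eq_of_le hvl with h | h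
    · rw [hFlow v hv h]
      have := S.lt u
      have := hpos v
      omega
    · rw [hFhigh v hv h.ge]
      obtain ⟨h1, h2⟩ := hanc v h.ge
      rw [S.forest.eq_of_length_eq h1 (S.forest.self_mem v) (h2.trans h.symm), h]
      have hsp : ∃ c ∈ W, A c v := ⟨u, hu, huv⟩
      simp only [σ, if_pos hsp, Nat.sub_self, Nat.zero_mod, Equiv.swap_apply_left]
      exact hγm v hv h.ge u hu huv
  by_cases hv : v ∈ W
  · have hul := S.level_lt_of_arc_to hP hu hv huv
    rw [hFlow u hu hul, hFW v hv]
    have := S.lt v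
    have := hpos u
    omega
  have hfin := S.final u v ⟨huv, hu, hv⟩
  have hne : (pth u).length ≠ (pth v).length := by
    intro he
    rcases hfin with h | h
    · omega
    · exact hA _ _ huv (S.forest.eq_of_length_eq h (S.forest.self_mem u) he.symm).symm
  rcases lt_or_ge (pth u).length l with hul | hul
  · rw [hFlow u hu hul]
    rcases lt_or_ge (pth v).length l with hvl | hvl
    · rw [hFlow v hv hvl]; omega
    · rw [hFhigh v hv hvl]
      have := hσ (anc v) _ (hmod ((pth v).length - l))
      have := hpos u
      omega
  rcases lt_or_ge (pth v).length l with hvl | hvl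
  · rw [hFhigh u hu hul, hFlow v hv hvl]
    have := hσ (anc u) _ (hmod ((pth u).length - l))
    have := hpos v
    omega
  rw [hFhigh u hu hul, hFhigh v hv hvl]
  have hbase : ((pth u).length - l) % (k + 1) ≠ ((pth v).length - l) % (k + 1) := by
    rcases hfin with h | h
    · have := S.level_le_add hP huv hul h
      exact mod_ne_mod (by omega) (by omega)
    · have hle := S.forest.length_le h
      have : (pth u).length < (pth v).length + k := by
        rcases lt_or_eq_of_le hvl with h' | h'
        · exact S.level_lt_add hA hP huv h' h
        · rw [← h']; exact hterm u hu v hv huv h'.symm h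
      exact (mod_ne_mod (by omega) (by omega)).symm
  obtain ⟨hru, hrul⟩ := hanc u hul
  obtain ⟨hrv, hrvl⟩ := hanc v hvl
  by_cases hsp : ∃ c ∈ W, A c (anc u) ∨ A c (anc v)
  · rw [S.eq_of_special hA hl hP hu hv huv hru hrul hrv hrvl hsp]
    exact fun h => hbase ((σ (anc v)).injective h)
  · have h1 : ¬ ∃ c ∈ W, A c (anc u) := fun ⟨c, hc, h⟩ => hsp ⟨c, hc, Or.inl h⟩
    have h2 : ¬ ∃ c ∈ W, A c (anc v) := fun ⟨c, hc, h⟩ => hsp ⟨c, hc, Or.inr h⟩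
    simp only [σ, if_neg h1, if_neg h2]
    exact hbase

end PartialColoring

theorem BackPath.hasP_of_arc {A : V → V → Prop} {k l : ℕ} {u v : V} {p q : List V}
    (hA : ∀ u v, A u v → u ≠ v) (hlk : l ≤ k) (hp : BackPath A u p) (hq : BackPath A v q)
    (h : A u v) (hv : v ∉ p) (hu : u ∉ q) (hd : p.Disjoint q) (hpk : k ≤ p.length)
    (hqk : k ≤ q.length) : HasP A k l :=
  ⟨v, u :: p, q, hp.cons h (hA _ _ h).symm hv, hq,
    List.disjoint_cons_left.2 ⟨hu, hd⟩, by simp; omega, by omega⟩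

namespace PartialColoring

variable {A : V → V → Prop} {k l : ℕ} {W C : Set V} {f : V → ℕ} {pth : V → List V}

/-- Enlarging the coloured part `W` of a partial colouring by a suitably coloured set `C`. -/
theorem extend [Fintype V] (S : PartialColoring A k l W f pth) (hA : ∀ u v, A u v → u ≠ v)
    (hlk : l ≤ k) (hP : ¬ HasP A k l) {g : V → ℕ}
    (hC : ∀ v ∈ C, v ∉ W ∧ l ≤ (pth v).length)
    (hlong : ∀ c ∈ C, ∃ p, BackPath A c p ∧ (∀ x ∈ p, x ∈ C) ∧ k ≤ p.length)
    (hg : ∀ c, g c < k + 1) (hproper : ∀ c ∈ C, ∀ d ∈ C, A c d → g c ≠ g d)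
    (hentry : ∀ r ∉ C, (∀ γ < k + 1, ∃ c ∈ C, A c r ∧ g c = γ) →
      ∃ p q e, BackPath A r p ∧ BackPath A r (q ++ [e]) ∧ p.Disjoint (q ++ [e]) ∧
        (∀ x ∈ p, x ∈ C) ∧ (∀ x ∈ q ++ [e], x ∈ C) ∧ k ≤ p.length ∧
        (l = 1 ∨ ∃ z ∉ W, l = (pth z).length + 1 ∧ A z e)) :
    ∃ f' pth', PartialColoring A k l (W ∪ C) f' pth' := by
  classical
  obtain ⟨pth₁, hfor₁, hsame⟩ := S.forest.exists_delete (C := C)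
  obtain ⟨pth₂, hfor, hfin, hle⟩ := hfor₁.exists_isFinal
  have hdis : ∀ x ∈ W, x ∉ C := fun x hx hx' => (hC x hx').1 hx
  have hkeep : ∀ z, (pth z).length < l → (pth z).length ≤ (pth₂ z).length := by
    intro z hz
    refine le_of_eq_of_le ?_ (hle z)
    rw [hsame z]
    intro x hx hxC
    have := (hC x hxC).2
    have := S.forest.length_le hx
    omega
  have hnoarc : ∀ w ∈ W, ∀ c ∈ C, ¬ A w c ∧ ¬ A c w := by
    intro w hw c hc
    obtain ⟨p, hp, hpW, hpk⟩ := S.long w hw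
    obtain ⟨q, hq, hqC, hqk⟩ := hlong c hc
    have h1 : w ∉ q := fun h => hdis w hw (hqC w h)
    have h2 : c ∉ p := fun h => hdis c (hpW c h) hc
    have h3 : p.Disjoint q := fun x hx hx' => hdis x (hpW x hx) (hqC x hx')
    exact ⟨fun h => hP (hp.hasP_of_arc hA hlk hq h h2 h1 h3 hpk hqk),
      fun h => hP (hq.hasP_of_arc hA hlk hp h h1 h2 h3.symm hqk hpk)⟩
  refine ⟨fun v => if v ∈ C then g v else f v, pth₂, hfor, hfin, ?_, ?_, ?_, ?_⟩
  · rintro c (hc | hc)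
    · obtain ⟨p, hp, hpW, hpk⟩ := S.long c hc
      exact ⟨p, hp, fun x hx => Or.inl (hpW x hx), hpk⟩
    · obtain ⟨p, hp, hpW, hpk⟩ := hlong c hc
      exact ⟨p, hp, fun x hx => Or.inr (hpW x hx), hpk⟩
  · intro c
    split_ifs
    exacts [hg c, S.lt c]
  · rintro c (hc | hc) d (hd | hd) h
    · simp only [if_neg (hdis c hc), if_neg (hdis d hd)]
      exact S.proper c hc d hd h
    · exact absurd h (hnoarc c hc d hd).1
    · exact absurd h (hnoarc d hd c hc).2
    · simp only [if_pos hc, if_pos hd]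
      exact hproper c hc d hd h
  · intro r hr hcol
    have hrW : r ∉ W := fun h => hr (Or.inl h)
    have hrC : r ∉ C := fun h => hr (Or.inr h)
    by_cases hCr : ∃ c ∈ C, A c r
    · obtain ⟨c, hc, hcr⟩ := hCr
      have hWr : ∀ w ∈ W, ¬ A w r := by
        intro w hw hwr
        obtain ⟨p, hp, hpW, hpk⟩ := S.long w hw
        obtain ⟨q, hq, hqC, hqk⟩ := hlong c hc
        refine hP ⟨r, w :: p, c :: q, hp.cons hwr (hA _ _ hwr).symm fun h => hrW (hpW r h),
          hq.cons hcr (hA _ _ hcr).symm fun h => hrC (hqC r h), ?_, by simp; omega,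
          by simp; omega⟩
        intro x hx hx'
        have h1 : x ∈ W := by
          rcases List.mem_cons.1 hx with rfl | hx
          exacts [hw, hpW x hx]
        have h2 : x ∈ C := by
          rcases List.mem_cons.1 hx' with rfl | hx'
          exacts [hc, hqC x hx']
        exact hdis x h1 h2
      obtain ⟨p, q, e, hp, hq, hd, hpC, hqC, hpk, hz⟩ := hentry r hrC fun γ hγ => by
        obtain ⟨c, hc | hc, hcr, hcγ⟩ := hcol γ hγ
        · exact absurd hcr (hWr c hc)
        · exact ⟨c, hc, hcr, by simpa [hc] using hcγ⟩
      refine ⟨p, q, e, hp, hq, hd, fun x hx => Or.inr (hpC x hx), fun x hx => Or.inr (hqC x hx),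
        hpk, hz.imp_right ?_⟩
      rintro ⟨z, hzW, hzl, hze⟩
      have hzl' := hkeep z (by omega)
      refine ⟨z, ?_, by omega, hze⟩
      rintro (h | h)
      · exact hzW h
      · have := (hC z h).2; omega
    · obtain ⟨p, q, e, hp, hq, hd, hpW, hqW, hpk, hz⟩ := S.entry r hrW fun γ hγ => by
        obtain ⟨c, hc | hc, hcr, hcγ⟩ := hcol γ hγ
        · exact ⟨c, hc, hcr, by simpa [hdis c hc] using hcγ⟩
        · exact absurd ⟨c, hc, hcr⟩ hCr
      refine ⟨p, q, e, hp, hq, hd, fun x hx => Or.inl (hpW x hx), fun x hx => Or.inl (hqW x hx),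
        hpk, hz.imp_right ?_⟩
      rintro ⟨z, hzW, hzl, hze⟩
      have hzlt := S.level_lt_of_arc_to hP hzW (hqW e (by simp)) hze
      have hzl' := hkeep z hzlt
      refine ⟨z, ?_, by omega, hze⟩
      rintro (h | h)
      · exact hzW h
      · have := (hC z h).2; omega

end PartialColoring

/-- `c 0, …, c (p - 1)` is a directed circuit of `A` through `y` whose vertices satisfy `Q`. -/
structure IsCircuit (A : V → V → Prop) (Q : V → Prop) (y : V) (p : ℕ) (c : ℕ → V) : Prop where
  zero : c 0 = y
  mem : ∀ i < p, Q (c i)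
  inj : ∀ i j, i < p → j < p → c i = c j → i = j
  step : ∀ i, i + 1 < p → A (c i) (c (i + 1))
  close : A (c (p - 1)) (c 0)

theorem IsForest.exists_walk {A : V → V → Prop} {pth : V → List V} (h : IsForest A pth)
    {x y : V} : y ∈ pth x → ∃ c : ℕ → V, ∃ n, c 0 = y ∧ c n = x ∧
      (pth x).length = (pth y).length + n ∧ (∀ i < n, A (c i) (c (i + 1))) ∧
      ∀ i ≤ n, c i ∈ pth x ∧ (pth (c i)).length = (pth y).length + i := by
  induction x using h.induct with
  | h1 x hx =>
    intro hy
    rw [hx] at hy; simp at hy; subst hy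
    exact ⟨fun _ => y, 0, rfl, rfl, rfl, by simp, fun i hi => ⟨h.self_mem y, by simp; omega⟩⟩
  | h2 u x hu hx ih =>
    intro hy
    by_cases hyx : y = x
    · subst hyx
      exact ⟨fun _ => y, 0, rfl, rfl, rfl, by simp, fun i hi => ⟨h.self_mem y, by simp; omega⟩⟩
    have hyu : y ∈ pth u := by
      rw [hx] at hy; exact (List.mem_cons.1 hy).resolve_left hyx
    obtain ⟨c, n, h0, hn, hlen, hstep, hmem⟩ := ih hyu
    have hxl : (pth x).length = (pth u).length + 1 := by rw [hx]; simp
    refine ⟨fun i => if i ≤ n then c i else x, n + 1, by simpa using h0, by simp, by omega, ?_, ?_⟩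
    · intro i hi
      rcases Nat.lt_succ_iff_lt_or_eq.1 hi with hi | rfl
      · simp only [if_pos hi.le, if_pos (Nat.succ_le_of_lt hi)]; exact hstep i hi
      · simp only [le_refl, if_true, hn]; simpa using hu
    · intro i hi
      by_cases hin : i ≤ n
      · simp only [if_pos hin]
        refine ⟨?_, (hmem i hin).2⟩
        rw [hx]; exact List.mem_cons_of_mem _ (hmem i hin).1
      · simp only [if_neg hin]
        exact ⟨h.self_mem x, by omega⟩

namespace IsCircuit

variable {A : V → V → Prop} {Q : V → Prop} {y : V} {p : ℕ} {c : ℕ → V}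

theorem exists_backPath (h : IsCircuit A Q y p c) {i : ℕ} (hi : i < p) :
    ∃ q, BackPath A (c i) q ∧ (∀ x ∈ q, ∃ j < p, c j = x) ∧ q.length = p - 1 := by
  have hg := backPath_of_fun (A := A) (n := p - 1)
    (g := fun t => c (if t ≤ i then i - t else i + p - t)) ?_ ?_
  · refine ⟨_, by simpa using hg, ?_, by simp⟩
    intro x hx
    simp only [List.mem_map, List.mem_range] at hx
    obtain ⟨t, ht, rfl⟩ := hx
    exact ⟨_, by split_ifs <;> omega, rfl⟩
  · intro t ht
    rcases lt_trichotomy t i with hti | rfl | hti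
    · rw [if_pos (by omega), if_pos hti.le]
      have := h.step (i - (t + 1)) (by omega)
      rwa [show i - (t + 1) + 1 = i - t by omega] at this
    · rw [if_neg (by omega), if_pos le_rfl]
      have := h.close
      rwa [show t + p - (t + 1) = p - 1 by omega, Nat.sub_self]
    · rw [if_neg (by omega), if_neg (by omega)]
      have := h.step (i + p - (t + 1)) (by omega)
      rwa [show i + p - (t + 1) + 1 = i + p - t by omega] at this
  · intro s t hs ht he
    have := h.inj _ _ (by split_ifs <;> omega) (by split_ifs <;> omega) he
    split_ifs at this <;> omega

/-- A path ending at the base point of a circuit extends to one ending at any vertex of it. -/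
theorem extend_backPath (h : IsCircuit A Q y p c) (hA : ∀ u v, A u v → u ≠ v) {s : List V}
    (hs : BackPath A y s) (hd : ∀ x ∈ s, ¬ Q x) : ∀ i < p, ∃ q, BackPath A (c i) q ∧
      s.length ≤ q.length ∧ ∀ x ∈ q, (∃ t < i, x = c t) ∨ ¬ Q x := by
  intro i
  induction i with
  | zero => exact fun _ => ⟨s, by rwa [h.zero], le_rfl, fun x hx => Or.inr (hd x hx)⟩
  | succ i ih =>
    intro hi
    obtain ⟨q, hq, hsq, hx⟩ := ih (by omega)
    have ha := h.step i hi
    refine ⟨c i :: q, hq.cons ha (hA _ _ ha).symm fun hm => ?_, by simp; omega, fun x hm => ?_⟩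
    · rcases hx _ hm with ⟨t, ht, he⟩ | hn
      · have := h.inj _ _ hi (by omega) he; omega
      · exact hn (h.mem _ hi)
    · rcases List.mem_cons.1 hm with rfl | hm
      · exact Or.inl ⟨i, by omega, rfl⟩
      · rcases hx x hm with ⟨t, ht, he⟩ | hn
        · exact Or.inl ⟨t, by omega, he⟩
        · exact Or.inr hn

theorem truncate (h : IsCircuit A Q y p c) {i : ℕ} (hi : i < p) (ha : A (c i) (c 0)) :
    IsCircuit A Q y (i + 1) c :=
  ⟨h.zero, fun j hj => h.mem j (by omega), fun a b ha hb => h.inj a b (by omega) (by omega),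
    fun j hj => h.step j (by omega), by simpa using ha⟩

theorem shortcut (h : IsCircuit A Q y p c) {i j : ℕ} (hij : i + 2 ≤ j) (hj : j < p)
    (ha : A (c i) (c j)) :
    IsCircuit A Q y (p - (j - i - 1)) fun t => c (if t ≤ i then t else t + (j - i - 1)) := by
  refine ⟨by simpa using h.zero, fun t ht => h.mem _ (by split_ifs <;> omega), ?_, ?_, ?_⟩
  · intro s t hs ht he
    have := h.inj _ _ (by split_ifs <;> omega) (by split_ifs <;> omega) he
    split_ifs at this <;> omega
  · intro t ht
    rcases lt_trichotomy t i with hti | rfl | hti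
    · rw [if_pos hti.le, if_pos (by omega)]; exact h.step t (by omega)
    · rw [if_pos le_rfl, if_neg (by omega), show t + 1 + (j - t - 1) = j by omega]; exact ha
    · rw [if_neg (by omega), if_neg (by omega)]
      have := h.step (t + (j - i - 1)) (by omega)
      rwa [show t + 1 + (j - i - 1) = t + (j - i - 1) + 1 by omega]
  · rw [if_neg (by omega), if_pos (Nat.zero_le _),
      show p - (j - i - 1) - 1 + (j - i - 1) = p - 1 by omega]
    exact h.close

theorem exists_coloring (h : IsCircuit A Q y p c) (hA : ∀ u v, A u v → u ≠ v) {k l : ℕ}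
    (hP : ¬ HasP A k l) (hk : 2 ≤ k) (hp : k + 1 ≤ p)
    (hmin : ∀ p' c', k + 1 ≤ p' → IsCircuit A Q y p' c' → p ≤ p') {s : List V}
    (hs : BackPath A y s) (hd : ∀ x ∈ s, ¬ Q x) (hsl : l ≤ s.length + 1) :
    ∃ g : V → ℕ, (∀ v, g v < k + 1) ∧ ∀ i < p, ∀ j < p, A (c i) (c j) → g (c i) ≠ g (c j) := by
  classical
  obtain ⟨F, hF, hprop⟩ := circuit_coloring (fun i j => A (c i) (c j)) k p hk hp h.step
    (fun i j hij hj hB g hg0 hgr hgi hga => by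
      obtain ⟨q, hq, hsq, hx⟩ := h.extend_backPath hA hs hd i (by omega)
      have hgp := backPath_of_fun (A := A) (n := k) (g := fun t => c (g t)) hga
        fun a b ha hb he => hgi a b ha hb (h.inj _ _ (hgr a ha).2 (hgr b hb).2 he)
      simp only [hg0] at hgp
      have hnot : ∀ m, i < m → m < p → c m ∉ c i :: q := by
        intro m him hm hmem
        rcases List.mem_cons.1 hmem with he | hmem
        · have := h.inj _ _ hm (by omega) he; omega
        rcases hx _ hmem with ⟨t, ht, he⟩ | hn
        · have := h.inj _ _ hm (by omega) he; omega
        · exact hn (h.mem _ hm)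
      refine hP ⟨c j, _, c i :: q, hgp, hq.cons hB (hA _ _ hB).symm fun hm =>
        hnot j hij hj (List.mem_cons_of_mem _ hm), ?_, by simp, by simp; omega⟩
      intro x hx1 hx2
      simp only [List.mem_map, List.mem_range] at hx1
      obtain ⟨t, ht, rfl⟩ := hx1
      exact hnot _ (hgr (t + 1) (by omega)).1 (hgr (t + 1) (by omega)).2 hx2)
    (fun i hki hi hB => by
      have := hmin (i + 1) c (by omega) (h.truncate hi hB)
      omega)
    (fun i j hij hj hB => by
      by_contra hlt
      have := hmin _ _ (by omega) (h.shortcut hij hj hB)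
      omega)
  have hidx : ∀ v, ∃ i, ∀ j < p, c j = v → i = j := by
    intro v
    by_cases hv : ∃ j < p, c j = v
    · obtain ⟨i, hi, rfl⟩ := hv
      exact ⟨i, fun j hj he => h.inj _ _ hi hj he.symm⟩
    · exact ⟨0, fun j hj he => absurd ⟨j, hj, he⟩ hv⟩
  choose idx hidx using hidx
  refine ⟨fun v => F (idx v), fun v => hF _, fun i hi j hj ha => ?_⟩
  dsimp only
  rw [hidx _ i hi rfl, hidx _ j hj rfl]
  exact hprop i j hi hj (fun he => hA _ _ ha (by rw [he])) ha

/-- A vertex with in-neighbours of `k + 1` colours on a circuit ends two disjoint paths along it. -/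
theorem exists_entry (h : IsCircuit A Q y p c) {k : ℕ} {g : V → ℕ} {r : V}
    (hr : ∀ i < p, c i ≠ r) (hcol : ∀ γ < k + 1, ∃ i < p, A (c i) r ∧ g (c i) = γ) :
    ∃ s q, BackPath A r s ∧ BackPath A r (q ++ [y]) ∧ s.Disjoint (q ++ [y]) ∧
      (∀ x ∈ s, ∃ i < p, c i = x) ∧ (∀ x ∈ q ++ [y], ∃ i < p, c i = x) ∧ k ≤ s.length := by
  classical
  set I : Finset ℕ := (Finset.range p).filter fun i => A (c i) r with hI
  have hmemI : ∀ i ∈ I, i < p ∧ A (c i) r := fun i hi => by simpa [hI] using hi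
  have hcard : k + 1 ≤ I.card := by
    have hsub : Finset.range (k + 1) ⊆ I.image fun i => g (c i) := by
      intro γ hγ
      obtain ⟨i, hi, hir, hiγ⟩ := hcol γ (Finset.mem_range.1 hγ)
      exact Finset.mem_image.2 ⟨i, by simp [hI, hi, hir], hiγ⟩
    have := (Finset.card_le_card hsub).trans Finset.card_image_le
    simpa using this
  have hne : I.Nonempty := Finset.card_pos.1 (by omega)
  obtain ⟨i, hi, hmin⟩ := I.exists_min_image id hne
  obtain ⟨j, hj, hmax⟩ := I.exists_max_image id hne
  have hsub : I ⊆ Finset.Icc i j := fun m hm => Finset.mem_Icc.2 ⟨hmin m hm, hmax m hm⟩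
  have hcard' := Finset.card_le_card hsub
  rw [Nat.card_Icc] at hcard'
  obtain ⟨hip, hir⟩ := hmemI i hi
  obtain ⟨hjp, hjr⟩ := hmemI j hj
  have hpath : ∀ m < p, A (c m) r → ∀ n ≤ m + 1,
      BackPath A r ((List.range n).map fun t => c (m - t)) := by
    intro m hm hmr n hn
    have := backPath_of_fun (A := A) (n := n) (g := fun t => if t = 0 then r else c (m + 1 - t))
      ?_ ?_
    · simpa using this
    · intro t ht
      rcases Nat.eq_zero_or_pos t with rfl | h0
      · simpa using hmr
      · have := h.step (m - t) (by omega)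
        simp only [Nat.add_eq_zero_iff, one_ne_zero, and_false, if_false, if_neg h0.ne']
        rwa [show m + 1 - (t + 1) = m - t by omega, show m + 1 - t = m - t + 1 by omega]
    · intro a b ha hb he
      split_ifs at he with h1 h2 h2
      · omega
      · exact absurd he.symm (hr _ (by omega))
      · exact absurd he (hr _ (by omega))
      · have := h.inj _ _ (by omega) (by omega) he; omega
  have hlast : (List.range (i + 1)).map (fun t => c (i - t)) =
      (List.range i).map (fun t => c (i - t)) ++ [y] := by
    rw [List.range_succ]; simp [h.zero]
  refine ⟨(List.range k).map fun t => c (j - t), (List.range i).map fun t => c (i - t),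
    hpath j hjp hjr k (by omega), hlast ▸ hpath i hip hir (i + 1) le_rfl, ?_, ?_, ?_, by simp⟩
  · rw [← hlast]
    intro x hx hx'
    simp only [List.mem_map, List.mem_range] at hx hx'
    obtain ⟨a, ha, rfl⟩ := hx
    obtain ⟨b, hb, he⟩ := hx'
    have := h.inj _ _ (by omega) (by omega) he
    omega
  · intro x hx
    simp only [List.mem_map, List.mem_range] at hx
    obtain ⟨a, ha, rfl⟩ := hx
    exact ⟨_, by omega, rfl⟩
  · rw [← hlast]
    intro x hx
    simp only [List.mem_map, List.mem_range] at hx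
    obtain ⟨a, ha, rfl⟩ := hx
    exact ⟨_, by omega, rfl⟩

end IsCircuit

namespace PartialColoring

variable {A : V → V → Prop} {k l : ℕ} {W : Set V} {f : V → ℕ} {pth : V → List V}

/-- A long backward arc to level `l` allows to enlarge the coloured part. -/
theorem exists_larger [Fintype V] (S : PartialColoring A k l W f pth)
    (hA : ∀ u v, A u v → u ≠ v) (hlk : l ≤ k) (hk : 2 ≤ k) (hP : ¬ HasP A k l) {x y : V}
    (hx : x ∉ W) (hy : y ∉ W) (hxy : A x y) (hyl : (pth y).length = l) (hyx : y ∈ pth x)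
    (hxl : l + k ≤ (pth x).length) :
    ∃ W' f' pth', W ⊂ W' ∧ PartialColoring A k l W' f' pth' := by
  classical
  let Q : V → Prop := fun v => v ∉ W ∧ l ≤ (pth v).length
  have hex : ∃ p, k + 1 ≤ p ∧ ∃ c, IsCircuit A Q y p c := by
    obtain ⟨c, n, h0, hn, hlen, hstep, hmem⟩ := S.forest.exists_walk hyx
    refine ⟨n + 1, by omega, c, h0, fun i hi => ?_, fun i j hi hj he => ?_,
      fun i hi => (hstep i (by omega)).1, ?_⟩
    · have := hmem i (by omega)
      exact ⟨S.forest.notMem_of_mem hx this.1, by omega⟩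
    · have h1 := hmem i (by omega)
      have h2 := hmem j (by omega)
      rw [he] at h1
      omega
    · simpa [hn, h0] using hxy
  obtain ⟨hp, c, hc⟩ := Nat.find_spec hex
  set p := Nat.find hex
  have hmin : ∀ p' c', k + 1 ≤ p' → IsCircuit A Q y p' c' → p ≤ p' :=
    fun p' c' h1 h2 => Nat.find_min' hex ⟨h1, c', h2⟩
  obtain ⟨g, hg, hgp⟩ := hc.exists_coloring hA hP hk hp hmin
    ((S.forest.backPath y).mono avoid_le)
    (fun z hz hQ => by
      have := S.forest.length_lt_of_mem_tail hz
      have := hQ.2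
      omega) (by simp; omega)
  obtain ⟨f', pth', S'⟩ := S.extend (C := {v | ∃ i < p, c i = v}) hA hlk hP (g := g)
    (by rintro _ ⟨i, hi, rfl⟩; exact hc.mem i hi)
    (by
      rintro _ ⟨i, hi, rfl⟩
      obtain ⟨q, hq, hqC, hql⟩ := hc.exists_backPath hi
      exact ⟨q, hq, hqC, by omega⟩)
    hg
    (by rintro _ ⟨i, hi, rfl⟩ _ ⟨j, hj, rfl⟩ ha; exact hgp i hi j hj ha)
    (by
      intro r hr hcol
      obtain ⟨s, q, h1, h2, h3, h4, h5, h6⟩ := hc.exists_entry (k := k) (g := g) (r := r)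
        (fun i hi he => hr ⟨i, hi, he⟩) fun γ hγ => by
          obtain ⟨_, ⟨i, hi, rfl⟩, ha, hγ⟩ := hcol γ hγ
          exact ⟨i, hi, ha, hγ⟩
      refine ⟨s, q, y, h1, h2, h3, h4, h5, h6, ?_⟩
      rcases S.forest y with h | ⟨z, hz, h⟩
      · left; rw [← hyl, h]; rfl
      · right; exact ⟨z, hz.2.1, by rw [← hyl, h]; rfl, hz.1⟩)
  refine ⟨_, f', pth', ?_, S'⟩
  exact (Set.ssubset_iff_of_subset Set.subset_union_left).2 ⟨y, Or.inr ⟨0, by omega, hc.zero⟩, hy⟩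

theorem exists_coloring_of_not_hasP [Fintype V] (S : PartialColoring A k l W f pth)
    (hA : ∀ u v, A u v → u ≠ v) (hl : 1 ≤ l) (hlk : l ≤ k) (hk : 2 ≤ k) (hP : ¬ HasP A k l) :
    ∃ F : V → ℕ, (∀ v, F v < k + l) ∧ ∀ u v, A u v → F u ≠ F v := by
  induction hn : Wᶜ.ncard using Nat.strong_induction_on generalizing W f pth with
  | _ n ih =>
    by_cases hterm : ∀ x ∉ W, ∀ y ∉ W, A x y → (pth y).length = l → y ∈ pth x →
      (pth x).length < l + k
    · exact S.exists_coloring hA hl hP hterm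
    push Not at hterm
    obtain ⟨x, hx, y, hy, hxy, hyl, hyx, hxl⟩ := hterm
    obtain ⟨W', f', pth', hW, S'⟩ := S.exists_larger hA hlk hk hP hx hy hxy hyl hyx hxl
    refine ih _ ?_ S' rfl
    rw [← hn]
    exact Set.ncard_lt_ncard (compl_lt_compl_iff_lt.2 hW) (Set.toFinite _)

end PartialColoring

theorem exists_coloring_of_not_hasP [Fintype V] {A : V → V → Prop} (hA : ∀ u v, A u v → u ≠ v)
    {k l : ℕ} (hl : 1 ≤ l) (hlk : l ≤ k) (hk : 2 ≤ k) (hP : ¬ HasP A k l) :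
    ∃ F : V → ℕ, (∀ v, F v < k + l) ∧ ∀ u v, A u v → F u ≠ F v := by
  have h0 : IsForest (Avoid A ∅) fun v => [v] := fun v => Or.inl rfl
  obtain ⟨pth, h1, h2, -⟩ := h0.exists_isFinal
  have S : PartialColoring A k l ∅ (fun _ => 0) pth :=
    ⟨h1, h2, by simp, by simp, by simp, fun r _ h => by
      obtain ⟨c, hc, -⟩ := h 0 (by omega)
      exact absurd hc (Set.notMem_empty c)⟩
  exact S.exists_coloring_of_not_hasP hA hl hlk hk hP

theorem HasP.containsP2 {D : V → V → Prop} {k l : ℕ} (h : HasP D k l) :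
    ContainsP2 D k l := by
  obtain ⟨w, p, q, hp, hq, hd, hpk, hql⟩ := h
  have hcp := List.isChain_iff_getElem.1 hp.1
  have hcq := List.isChain_iff_getElem.1 hq.1
  have hcross : ∀ (a b : ℕ) (ha : a < (w :: p).length) (hb : b < (w :: q).length),
      (w :: p)[a] = (w :: q)[b] → a = 0 ∧ b = 0 := by
    intro a b ha hb he
    rcases a with _ | a <;> rcases b with _ | b
    · exact ⟨rfl, rfl⟩
    · exact absurd (by simp at he; rw [he]; simp) hq.notMem
    · exact absurd (by simp at he; rw [← he]; simp) hp.notMem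
    · simp only [List.getElem_cons_succ] at he
      exact absurd (List.getElem_mem _) (he ▸ hd (List.getElem_mem (by simpa using ha)))
  simp only [List.length_cons] at hcp hcq hcross
  refine ⟨fun i => if h : i.1 ≤ k then (w :: p)[k - i.1]'(by simp; omega)
    else (w :: q)[i.1 - k]'(by simp; omega), ?_, ?_, ?_⟩
  · rintro ⟨i, hi⟩ ⟨j, hj⟩ he
    simp only [Fin.mk.injEq]
    dsimp only at he
    split_ifs at he with h1 h2 h2
    · have := (List.Nodup.getElem_inj_iff hp.2).1 he; omega
    · have := hcross _ _ _ _ he; omega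
    · have := hcross _ _ _ _ he.symm; omega
    · have := (List.Nodup.getElem_inj_iff hq.2).1 he; omega
  · intro i hi
    dsimp only
    rw [dif_pos hi.le, dif_pos (by omega)]
    have := hcp (k - (i + 1)) (by omega)
    simpa only [show k - (i + 1) + 1 = k - i by omega] using this
  · intro i hi
    dsimp only
    rw [dif_neg (by omega)]
    have := hcq (i - k) (by omega)
    by_cases hik : i ≤ k
    · have : i = k := by omega
      subst this
      rw [dif_pos le_rfl]
      simpa using this
    · rw [dif_neg hik]
      simpa only [show i - k + 1 = i + 1 - k by omega] using this

end TwoBlocks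

open TwoBlocks

/-- Addario-Berry, Havet, Thomassé: for `n ≥ 4`, every digraph with chromatic
number at least `n` contains every oriented path of length `n - 1` with two
blocks. -/
theorem two_blocks_universal {V : Type*} [Fintype V] (D : V → V → Prop) (n : ℕ)
    (hn : 4 ≤ n)
    (hchrom : (n : ℕ∞) ≤ (SimpleGraph.fromRel D).chromaticNumber)
    (k₁ k₂ : ℕ) (h₁ : 1 ≤ k₁) (h₂ : 1 ≤ k₂) (hsum : k₁ + k₂ = n - 1) :
    ContainsP2 D k₁ k₂ := by
  by_contra hcon
  have hP : ¬ HasP (fun u v => D u v ∧ u ≠ v) k₁ k₂ := fun h =>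
    hcon (h.mono fun _ _ => And.left).containsP2
  have hcol : ∃ F : V → ℕ, (∀ v, F v < k₁ + k₂) ∧ ∀ u v, D u v ∧ u ≠ v → F u ≠ F v := by
    rcases le_total k₂ k₁ with h | h
    · exact exists_coloring_of_not_hasP (fun _ _ => And.right) h₂ h (by omega) hP
    · rw [add_comm]
      exact exists_coloring_of_not_hasP (fun _ _ => And.right) h₁ h (by omega)
        fun hP' => hP hP'.symm
  obtain ⟨F, hF, hprop⟩ := hcol
  have hc : (SimpleGraph.fromRel D).Colorable (k₁ + k₂) := by
    refine ⟨SimpleGraph.Coloring.mk (fun v => ⟨F v, hF v⟩) fun {u v} huv he => ?_⟩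
    rw [SimpleGraph.fromRel_adj] at huv
    have he' := Fin.mk.inj he
    rcases huv.2 with h | h
    · exact hprop u v ⟨h, huv.1⟩ he'
    · exact hprop v u ⟨h, huv.1.symm⟩ he'.symm
  have := hchrom.trans hc.chromaticNumber_le
  have := Nat.cast_le.1 this
  omega
end
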